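/- (Burke's theorem for the stationary M/M/1 queue.) Let (Ω, F, P) be a probability space and let A and S be independent random locally finite subsets of ℝ such that A is a homogeneous Poisson process of rate λ and S is a homogeneous Poisson process of rate ρ, where 0 < λ < ρ. Then almost surely A and S are disjoint and the pair (A,S) is admissible, and the departure process D(A,S) is a homogeneous Poisson process of rate λ. -/

import Mathlib

open Set Filter Classical

noncomputable section

/-- A subset of `ℝ` is locally finite if its intersection with every bounded interval
is finite. -/
def LocFin (B : Set ℝ) : Prop := ∀ a b : ℝ, (B ∩ Set.Icc a b).Finite

/-- The right-continuous random-walk function `Z` associated to arrivals `A` and services `S`: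
`Z 0 = 0` and `Z s - Z r = |A ∩ (r,s]| - |S ∩ (r,s]|` for `r < s`;
`Z` jumps up by 1 at points of `A` and down by 1 at points of `S`. -/
def Zfun (A S : Set ℝ) (r : ℝ) : ℤ :=
  if 0 ≤ r then ((A ∩ Set.Ioc 0 r).ncard : ℤ) - ((S ∩ Set.Ioc 0 r).ncard : ℤ)
  else ((S ∩ Set.Ioc r 0).ncard : ℤ) - ((A ∩ Set.Ioc r 0).ncard : ℤ)

/-- The pair `(A,S)` is admissible: both sets locally finite and disjoint, and
`Z_r → -∞` as `r → ∞`, `Z_r → +∞` as `r → -∞`. -/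
def Admissible (A S : Set ℝ) : Prop :=
  LocFin A ∧ LocFin S ∧ Disjoint A S ∧
  Tendsto (Zfun A S) atTop atBot ∧ Tendsto (Zfun A S) atBot atTop

/-- Unused service times: times `r ∈ S` where `Z` attains a new record down, i.e.
`Z r < Z r'` for all `r' < r` (equivalently `Z_r < inf_{r' < r} Z_{r'}`). -/
def Unused (A S : Set ℝ) : Set ℝ := {r ∈ S | ∀ r' < r, Zfun A S r < Zfun A S r'}

/-- Departure times: service times that are not unused. -/
def Dep (A S : Set ℝ) : Set ℝ := S \ Unused A S

/-- `B` has two-sided density `ρ`. -/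
def HasDens (B : Set ℝ) (ρ : ℝ) : Prop :=
  Tendsto (fun s : ℝ => ((B ∩ Set.Icc 0 s).ncard : ℝ) / s) atTop (nhds ρ) ∧
  Tendsto (fun s : ℝ => ((B ∩ Set.Icc (-s) 0).ncard : ℝ) / s) atTop (nhds ρ)

/-- The queue length `Q_r = Z_r - min_{r' ≤ r} Z_{r'}`. -/
def Qlen (A S : Set ℝ) (r : ℝ) : ℤ := Zfun A S r - sInf (Zfun A S '' Set.Iic r)

/-- `Dseq α k m = D^{(m+1)}(α_k, α_{k+1}, …, α_{k+m})`, the tandem departure operator: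
`D^{(1)}(α¹) = α¹` and `D^{(n)}(α¹,…,αⁿ) = D(D^{(n-1)}(α¹,…,α^{n-1}), αⁿ)`. -/
def Dseq (α : ℕ → Set ℝ) (k : ℕ) : ℕ → Set ℝ
  | 0 => α k
  | m + 1 => Dep (Dseq α k m) (α (k + m + 1))

open MeasureTheory ProbabilityTheory
open scoped NNReal

/-- The σ-algebra on locally finite point configurations (subsets of `ℝ`) generated by the
counting maps `x ↦ |x ∩ B|` for bounded measurable `B ⊆ ℝ`. -/
def pointMS : MeasurableSpace (Set ℝ) :=
  MeasurableSpace.generateFrom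
    {s | ∃ (B : Set ℝ) (n : ℕ), MeasurableSet B ∧ Bornology.IsBounded B ∧
      s = {x : Set ℝ | (x ∩ B).ncard = n}}

/-- A random locally finite set `X : Ω → Set ℝ` is a homogeneous Poisson process of rate `μ`
if `X` is a.s. locally finite and, for every finite collection of pairwise disjoint bounded
measurable sets `B₁,…,B_m`, the counts `|X ∩ B₁|,…,|X ∩ B_m|` are independent and `|X ∩ Bᵢ|`
is Poisson distributed with mean `μ · Leb(Bᵢ)`. -/
def IsPoissonPP {Ω : Type*} [MeasurableSpace Ω] (P : Measure Ω) (X : Ω → Set ℝ)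
    (μ : ℝ≥0) : Prop :=
  (∀ᵐ ω ∂P, LocFin (X ω)) ∧
  ∀ (m : ℕ) (B : Fin m → Set ℝ),
    (∀ i, MeasurableSet (B i)) → (∀ i, Bornology.IsBounded (B i)) →
    (Pairwise fun i j => Disjoint (B i) (B j)) →
    (ProbabilityTheory.iIndepFun (m := fun _ : Fin m => (inferInstance : MeasurableSpace ℕ))
      (fun i ω => (X ω ∩ B i).ncard) P ∧
    ∀ i, Measure.map (fun ω => (X ω ∩ B i).ncard) P =
      ProbabilityTheory.poissonMeasure (μ * (volume (B i)).toNNReal))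

/-- Independence of two random point configurations, with respect to the σ-algebra
generated by the counting maps. -/
def PPIndep {Ω : Type*} [MeasurableSpace Ω] (P : Measure Ω) (X Y : Ω → Set ℝ) : Prop :=
  @ProbabilityTheory.IndepFun Ω (Set ℝ) (Set ℝ) _ pointMS pointMS X Y P


lemma exp_neg_le_quad (r : ℝ) (hr : 0 ≤ r) : Real.exp (-r) ≤ 1 - r + r ^ 2 := by
  have h1 := Real.add_one_le_exp r
  have h2 : Real.exp (-r) * Real.exp r = 1 := by rw [← Real.exp_add]; simp
  have h3 := Real.exp_pos (-r)
  have h4 : Real.exp (-r) * (1 + r) ≤ (1 - r + r ^ 2) * (1 + r) := by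
    nlinarith [pow_nonneg hr 3]
  exact le_of_mul_le_mul_right h4 (by linarith)

lemma pois_ge1 (r : ℝ≥0) : (poissonMeasure r).real {n | 1 ≤ n} ≤ r := by
  have : {n : ℕ | 1 ≤ n} = {0}ᶜ := by ext n; simp; omega
  rw [this, probReal_compl_eq_one_sub (by measurability), poissonMeasure_real_singleton]
  have := Real.add_one_le_exp (-(r : ℝ))
  simp; linarith

lemma pois_ge2 (r : ℝ≥0) : (poissonMeasure r).real {n | 2 ≤ n} ≤ (r : ℝ) ^ 2 := by
  have : {n : ℕ | 2 ≤ n} = ({0} ∪ {1})ᶜ := by ext n; simp; omega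
  rw [this, probReal_compl_eq_one_sub (by measurability),
    measureReal_union (by simp) (by measurability),
    poissonMeasure_real_singleton, poissonMeasure_real_singleton]
  have := Real.add_one_le_exp (-(r : ℝ))
  simp only [pow_zero, mul_one, Nat.factorial_zero, Nat.cast_one, div_one, pow_one,
    Nat.factorial_one]
  nlinarith [r.2]

lemma pois_integrable (r : ℝ≥0) (g : ℕ → ℂ) (hg : ∀ n, ‖g n‖ ≤ 1) :
    Integrable g (poissonMeasure r) :=
  Integrable.of_bound (Measurable.of_discrete).aestronglyMeasurable 1 (ae_of_all _ hg)

lemma pois_approx (r : ℝ≥0) (g : ℕ → ℂ) (hg : ∀ n, ‖g n‖ ≤ 1) :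
    ‖∫ n, g n ∂(poissonMeasure r) - ((1 - (r : ℂ)) * g 0 + r * g 1)‖ ≤ 3 * (r : ℝ) ^ 2 := by
  have e1 := Real.add_one_le_exp (-(r : ℝ))
  have e2 := exp_neg_le_quad r r.2
  have hr := r.2
  have hs := hasSum_integral_poissonMeasure (pois_integrable r g hg)
  have h1 := hasSum_one_poissonMeasure r
  set p : ℕ → ℝ := fun n => Real.exp (-r) * r ^ n / (n.factorial) with hp
  have hp0 : p 0 = Real.exp (-r) := by simp [hp]
  have hp1 : p 1 = Real.exp (-r) * r := by simp [hp]
  have hpn : ∀ n, 0 ≤ p n := fun n => by simp only [hp]; positivity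
  have t1 := h1.summable.sum_add_tsum_nat_add 2
  have t2 := hs.summable.sum_add_tsum_nat_add 2
  rw [h1.tsum_eq] at t1
  rw [hs.tsum_eq] at t2
  simp only [Finset.sum_range_succ, Finset.range_zero, Finset.sum_empty, zero_add] at t1 t2
  rw [hp0, hp1] at t1
  change p 0 • g 0 + p 1 • g 1 + ∑' i, p (i + 2) • g (i + 2) = _ at t2
  have hb : ‖∑' i, p (i + 2) • g (i + 2)‖ ≤ ∑' i, p (i + 2) := by
    have hsum : Summable fun i => p (i + 2) := (summable_nat_add_iff 2).2 h1.summable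
    refine tsum_of_norm_bounded hsum.hasSum fun i => ?_
    rw [norm_smul, Real.norm_of_nonneg (hpn _)]
    exact mul_le_of_le_one_right (hpn _) (hg _)
  rw [← t2]
  have hd : p 0 • g 0 + p 1 • g 1 + ∑' i, p (i + 2) • g (i + 2) - ((1 - (r : ℂ)) * g 0 + r * g 1)
      = ((p 0 - (1 - r) : ℝ) : ℂ) * g 0 + ((p 1 - r : ℝ) : ℂ) * g 1
        + ∑' i, p (i + 2) • g (i + 2) := by
    rw [Complex.real_smul, Complex.real_smul]; push_cast; ring
  rw [hd]
  have n0 : ‖((p 0 - (1 - r) : ℝ) : ℂ) * g 0‖ ≤ (r : ℝ) ^ 2 := by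
    rw [norm_mul, Complex.norm_real, Real.norm_eq_abs]
    refine (mul_le_of_le_one_right (abs_nonneg _) (hg 0)).trans ?_
    rw [hp0, abs_le]; constructor <;> nlinarith
  have n1 : ‖((p 1 - r : ℝ) : ℂ) * g 1‖ ≤ (r : ℝ) ^ 2 := by
    rw [norm_mul, Complex.norm_real, Real.norm_eq_abs]
    refine (mul_le_of_le_one_right (abs_nonneg _) (hg 1)).trans ?_
    have : Real.exp (-r) ≤ 1 := by rw [Real.exp_le_one_iff]; linarith
    rw [hp1, abs_le]; constructor <;> nlinarith
  have n2 : ∑' i, p (i + 2) ≤ (r : ℝ) ^ 2 := by nlinarith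
  refine (norm_add₃_le).trans ?_
  linarith

/-- one step operator -/
def Pop (l r : ℝ≥0) (z : ℂ) (f : ℕ → ℂ) (q : ℕ) : ℂ :=
  ∫ a, ∫ s, z ^ (min (q + a) s) * f (q + a - s) ∂(poissonMeasure r) ∂(poissonMeasure l)

lemma step_norm {z : ℂ} (hz : ‖z‖ ≤ 1) {f : ℕ → ℂ} (hf : ∀ n, ‖f n‖ ≤ 1) (m k : ℕ) :
    ‖z ^ m * f k‖ ≤ 1 := by
  rw [norm_mul, norm_pow]
  exact mul_le_one₀ (pow_le_one₀ (norm_nonneg _) hz) (norm_nonneg _) (hf _)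

lemma norm_integral_le_one {α : Type*} [MeasurableSpace α] (μ : Measure α) [IsProbabilityMeasure μ]
    (g : α → ℂ) (hg : ∀ n, ‖g n‖ ≤ 1) : ‖∫ n, g n ∂μ‖ ≤ 1 := by
  simpa using norm_integral_le_of_norm_le_const (μ := μ) (ae_of_all _ hg)

lemma Pop_norm (l r : ℝ≥0) {z : ℂ} (hz : ‖z‖ ≤ 1) {f : ℕ → ℂ} (hf : ∀ n, ‖f n‖ ≤ 1) (q : ℕ) :
    ‖Pop l r z f q‖ ≤ 1 := by
  refine norm_integral_le_one _ _ fun a => ?_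
  exact norm_integral_le_one _ _ fun s => step_norm hz hf _ _

/-- approximate generator step -/
def Gap (l r : ℝ≥0) (z : ℂ) (f : ℕ → ℂ) (q : ℕ) : ℂ :=
  (1 - l - r) * f q + l * f (q + 1) + r * (z ^ (min q 1) * f (q - 1))

lemma Pop_approx (l r : ℝ≥0) (hl : l ≤ 1) {z : ℂ} (hz : ‖z‖ ≤ 1) {f : ℕ → ℂ}
    (hf : ∀ n, ‖f n‖ ≤ 1) (q : ℕ) :
    ‖Pop l r z f q - Gap l r z f q‖ ≤ 5 * ((l : ℝ) + r) ^ 2 := by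
  have hl' : (l : ℝ) ≤ 1 := by exact_mod_cast hl
  have l0 : (0:ℝ) ≤ l := NNReal.coe_nonneg l
  have r0 := r.2
  set h : ℕ → ℕ → ℂ := fun a s => z ^ (min (q + a) s) * f (q + a - s) with hh
  have hb : ∀ a s, ‖h a s‖ ≤ 1 := fun a s => step_norm hz hf _ _
  set H : ℕ → ℂ := fun a => ∫ s, h a s ∂(poissonMeasure r) with hH
  have hHb : ∀ a, ‖H a‖ ≤ 1 := fun a => norm_integral_le_one _ _ (hb a)
  have b := pois_approx l H hHb
  have b0 := pois_approx r (h 0) (hb 0)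
  have b1 := pois_approx r (h 1) (hb 1)
  have hP : Pop l r z f q = ∫ a, H a ∂(poissonMeasure l) := rfl
  have hG : Gap l r z f q = (1 - l - r) * h 0 0 + l * h 1 0 + r * h 0 1 := by
    simp [Gap, hh]
  set I := ∫ a, H a ∂(poissonMeasure l)
  rw [hP, hG]
  have key : I - ((1 - l - r) * h 0 0 + l * h 1 0 + r * h 0 1)
      = (I - ((1 - (l : ℂ)) * H 0 + l * H 1))
        + ((1 - l : ℝ) : ℂ) * (H 0 - ((1 - (r : ℂ)) * h 0 0 + r * h 0 1))
        + ((l : ℝ) : ℂ) * (H 1 - ((1 - (r : ℂ)) * h 1 0 + r * h 1 1))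
        + ((l * r : ℝ) : ℂ) * (h 0 0 - h 0 1 - h 1 0 + h 1 1) := by
    push_cast; ring
  rw [key]
  have n4 : ‖h 0 0 - h 0 1 - h 1 0 + h 1 1‖ ≤ 4 := by
    have := norm_add_le (h 0 0 - h 0 1 - h 1 0) (h 1 1)
    have := norm_sub_le (h 0 0 - h 0 1) (h 1 0)
    have := norm_sub_le (h 0 0) (h 0 1)
    linarith [hb 0 0, hb 0 1, hb 1 0, hb 1 1]
  have m1 : ‖((1 - l : ℝ) : ℂ) * (H 0 - ((1 - (r : ℂ)) * h 0 0 + r * h 0 1))‖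
      ≤ (1 - l) * (3 * (r : ℝ) ^ 2) := by
    rw [norm_mul, Complex.norm_real, Real.norm_of_nonneg (by linarith)]
    exact mul_le_mul_of_nonneg_left b0 (by linarith)
  have m2 : ‖((l : ℝ) : ℂ) * (H 1 - ((1 - (r : ℂ)) * h 1 0 + r * h 1 1))‖
      ≤ l * (3 * (r : ℝ) ^ 2) := by
    rw [norm_mul, Complex.norm_real, Real.norm_of_nonneg l0]
    exact mul_le_mul_of_nonneg_left b1 l0
  have m3 : ‖((l * r : ℝ) : ℂ) * (h 0 0 - h 0 1 - h 1 0 + h 1 1)‖ ≤ (l * r) * 4 := by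
    rw [norm_mul, Complex.norm_real, Real.norm_of_nonneg (by positivity)]
    exact mul_le_mul_of_nonneg_left n4 (by positivity)
  refine (norm_add_le _ _).trans ?_
  refine (add_le_add (norm_add₃_le) le_rfl).trans ?_
  have : (0:ℝ) ≤ l * r := by positivity
  nlinarith [sq_nonneg ((l : ℝ) - r)]

/-- geometric weights -/
def gw (x : ℝ) (q : ℕ) : ℝ := (1 - x) * x ^ q

lemma gw_hasSum {x : ℝ} (h0 : 0 ≤ x) (h1 : x < 1) : HasSum (gw x) 1 := by
  have := (hasSum_geometric_of_lt_one h0 h1).mul_left (1 - x)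
  rwa [mul_inv_cancel₀ (by linarith)] at this

lemma gw_nonneg {x : ℝ} (h0 : 0 ≤ x) (h1 : x < 1) (q : ℕ) : 0 ≤ gw x q :=
  mul_nonneg (by linarith) (pow_nonneg h0 q)

lemma gw_summable {x : ℝ} (h0 : 0 ≤ x) (h1 : x < 1) {f : ℕ → ℂ} (hf : ∀ n, ‖f n‖ ≤ 1) :
    Summable fun q => (gw x q : ℂ) * f q := by
  refine Summable.of_norm_bounded (gw_hasSum h0 h1).summable fun q => ?_
  rw [norm_mul, Complex.norm_real, Real.norm_of_nonneg (gw_nonneg h0 h1 q)]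
  exact mul_le_of_le_one_right (gw_nonneg h0 h1 q) (hf _)

lemma gw_bound {x C : ℝ} (h0 : 0 ≤ x) (h1 : x < 1) {f : ℕ → ℂ} (hf : ∀ n, ‖f n‖ ≤ C) :
    ‖∑' q, (gw x q : ℂ) * f q‖ ≤ C := by
  have := (gw_hasSum h0 h1).mul_right C
  rw [one_mul] at this
  refine tsum_of_norm_bounded this fun q => ?_
  rw [norm_mul, Complex.norm_real, Real.norm_of_nonneg (gw_nonneg h0 h1 q)]
  exact mul_le_mul_of_nonneg_left (hf _) (gw_nonneg h0 h1 q)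

lemma Gap_pi (l r : ℝ≥0) (hlr : l < r) {z : ℂ} (hz : ‖z‖ ≤ 1) {f : ℕ → ℂ}
    (hf : ∀ n, ‖f n‖ ≤ 1) {x : ℝ} (hx : x * r = l) :
    HasSum (fun q => (gw x q : ℂ) * Gap l r z f q)
      ((1 + l * (z - 1)) * ∑' q, (gw x q : ℂ) * f q) := by
  have hr : (0 : ℝ) < r := lt_of_le_of_lt l.2 (by exact_mod_cast hlr)
  have hx' : x = l / r := by field_simp; linarith
  have h0 : 0 ≤ x := by rw [hx']; positivity
  have h1 : x < 1 := by rw [hx', div_lt_one hr]; exact_mod_cast hlr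
  have s0 := (gw_summable h0 h1 hf).hasSum
  have s1 := (gw_summable h0 h1 (f := fun n => f (n + 1)) fun n => hf _).hasSum
  set p := ∑' q, (gw x q : ℂ) * f q with hp
  set p1 := ∑' q, (gw x q : ℂ) * f (q + 1) with hp1
  have hxr : (x : ℂ) * r = l := by exact_mod_cast congrArg (fun t : ℝ => (t : ℂ)) hx
  have gs : ∀ q, (r : ℂ) * gw x (q + 1) = l * gw x q := fun q => by
    simp only [gw]; push_cast; rw [pow_succ, ← hxr]; ring
  -- p in terms of p1
  have hpp : (r : ℂ) * p = r * (gw x 0 * f 0) + l * p1 := by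
    have := (hasSum_nat_add_iff' (f := fun q => (gw x q : ℂ) * f q) 1).2 s0
    have h2 := this.mul_left (r : ℂ)
    have h3 := s1.mul_left (l : ℂ)
    have h4 : (fun q => (r : ℂ) * ((gw x (q + 1) : ℂ) * f (q + 1)))
        = fun q => (l : ℂ) * ((gw x q : ℂ) * f (q + 1)) := by
      ext q; rw [← mul_assoc, gs, mul_assoc]
    rw [h4] at h2
    have := h2.unique h3
    simp at this
    linear_combination this
  have s2 : HasSum (fun q => (r : ℂ) * ((gw x q : ℂ) * (z ^ (min q 1) * f (q - 1))))
      (r * (gw x 0 * f 0) + l * z * p) := by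
    rw [← hasSum_nat_add_iff' 1]
    have h3 := s0.mul_left ((l : ℂ) * z)
    convert! h3 using 1
    · ext q
      simp only [Nat.add_sub_cancel, show min (q + 1) 1 = 1 by omega, pow_one]
      linear_combination z * f q * gs q
    · simp
  have tot := ((s0.mul_left (1 - (l : ℂ) - r)).add (s1.mul_left (l : ℂ))).add s2
  convert! tot using 1
  · ext q; simp only [Gap]; ring
  · linear_combination hpp

lemma Pop_pi (l r : ℝ≥0) (hlr : l < r) (hl : 2 * (l : ℝ) ≤ 1) {z : ℂ} (hz : ‖z‖ ≤ 1) {f : ℕ → ℂ}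
    (hf : ∀ n, ‖f n‖ ≤ 1) {x : ℝ} (hx : x * r = l) :
    ‖∑' q, (gw x q : ℂ) * Pop l r z f q
      - Complex.exp (l * (z - 1)) * ∑' q, (gw x q : ℂ) * f q‖ ≤ 9 * ((l : ℝ) + r) ^ 2 := by
  have hr : (0 : ℝ) < r := lt_of_le_of_lt l.2 (by exact_mod_cast hlr)
  have hx' : x = l / r := by field_simp; linarith
  have h0 : 0 ≤ x := by rw [hx']; positivity
  have h1 : x < 1 := by rw [hx', div_lt_one hr]; exact_mod_cast hlr
  have sP := gw_summable h0 h1 (Pop_norm l r hz hf)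
  have sG := Gap_pi l r hlr hz hf hx
  have hl1 : l ≤ 1 := by
    have : (l : ℝ) ≤ 1 := by linarith [l.2]
    exact_mod_cast this
  have e1 := gw_bound h0 h1 (Pop_approx l r hl1 hz hf)
  have e2 : ∑' q, (gw x q : ℂ) * (Pop l r z f q - Gap l r z f q)
     = ∑' q, (gw x q : ℂ) * Pop l r z f q - (1 + l * (z - 1)) * ∑' q, (gw x q : ℂ) * f q := by
    rw [← sG.tsum_eq, ← sP.tsum_sub sG.summable]
    congr 1; ext q; ring
  rw [e2] at e1
  have e3 := gw_bound h0 h1 hf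
  set p := ∑' q, (gw x q : ℂ) * f q
  set pP := ∑' q, (gw x q : ℂ) * Pop l r z f q
  have hz2 : ‖(l : ℂ) * (z - 1)‖ ≤ 2 * l := by
    rw [norm_mul]
    have : ‖z - 1‖ ≤ 2 := (norm_sub_le _ _).trans (by rw [norm_one]; linarith)
    have h5 : ‖(l : ℂ)‖ = l := by
      rw [show (l : ℂ) = ((l : ℝ) : ℂ) from rfl, Complex.norm_real, Real.norm_of_nonneg (NNReal.coe_nonneg l)]
    rw [h5]; nlinarith [l.2]
  have e4 := Complex.norm_exp_sub_one_sub_id_le (hz2.trans hl)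
  have e5 : pP - Complex.exp (l * (z - 1)) * p = (pP - (1 + l * (z - 1)) * p)
     - (Complex.exp (l * (z - 1)) - 1 - l * (z - 1)) * p := by ring
  rw [e5]
  refine (norm_sub_le _ _).trans ?_
  rw [norm_mul]
  have e6 : ‖Complex.exp (l * (z - 1)) - 1 - l * (z - 1)‖ * ‖p‖ ≤ (2 * l) ^ 2 := by
    refine (mul_le_of_le_one_right (norm_nonneg _) e3).trans (e4.trans ?_)
    exact pow_le_pow_left₀ (norm_nonneg _) hz2 2
  nlinarith [l.2, r.2, mul_nonneg l.2 r.2]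

/-- path weight functional on finite sequences -/
def WF : (K : ℕ) → (ℕ → ℂ) → ℕ → (Fin K → ℕ) → (Fin K → ℕ) → ℂ
  | 0, _, _, _, _ => 1
  | K + 1, z, q, a, s => z 0 ^ (min (q + a 0) (s 0)) *
      WF K (fun k => z (k + 1)) (q + a 0 - s 0) (fun i => a i.succ) (fun i => s i.succ)

lemma WF_norm (K : ℕ) : ∀ (z : ℕ → ℂ) (_ : ∀ k, ‖z k‖ ≤ 1) (q : ℕ) (a s : Fin K → ℕ),
    ‖WF K z q a s‖ ≤ 1 := by
  induction K with
  | zero => intro z hz q a s; simp [WF]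
  | succ K ih =>
    intro z hz q a s
    rw [WF, norm_mul, norm_pow]
    exact mul_le_one₀ (pow_le_one₀ (norm_nonneg _) (hz 0)) (norm_nonneg _)
      (ih _ (fun k => hz _) _ _ _)

/-- expectation of the path weight -/
def EK (l r : ℝ≥0) (K : ℕ) (z : ℕ → ℂ) (q : ℕ) : ℂ :=
  ∫ x : (Fin K → ℕ) × (Fin K → ℕ), WF K z q x.1 x.2
    ∂((Measure.pi fun _ => poissonMeasure l).prod (Measure.pi fun _ => poissonMeasure r))

lemma EK_norm (l r : ℝ≥0) (K : ℕ) (z : ℕ → ℂ) (hz : ∀ k, ‖z k‖ ≤ 1) (q : ℕ) :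
    ‖EK l r K z q‖ ≤ 1 :=
  norm_integral_le_one _ _ fun x => WF_norm K z hz q x.1 x.2

lemma bdd_integrable {α : Type*} [MeasurableSpace α] [Countable α] [MeasurableSingletonClass α]
    (μ : Measure α) [IsProbabilityMeasure μ]
    (g : α → ℂ) (hg : ∀ n, ‖g n‖ ≤ 1) : Integrable g μ :=
  Integrable.of_bound (Measurable.of_discrete).aestronglyMeasurable 1 (ae_of_all _ hg)

lemma integral_pi_succ (K : ℕ) (r : ℝ≥0) (g : (Fin (K + 1) → ℕ) → ℂ) (hg : ∀ x, ‖g x‖ ≤ 1) :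
    ∫ x, g x ∂(Measure.pi fun _ : Fin (K + 1) => poissonMeasure r)
      = ∫ a, ∫ y, g (Fin.cons a y) ∂(Measure.pi fun _ : Fin K => poissonMeasure r)
          ∂(poissonMeasure r) := by
  rw [← ((measurePreserving_piFinSuccAbove (fun _ : Fin (K + 1) => poissonMeasure r)
    0).symm).integral_comp']
  rw [integral_prod]
  · simp_rw [MeasurableEquiv.piFinSuccAbove_symm_apply, Fin.insertNthEquiv,
      Fin.insertNth_zero, Equiv.coe_fn_mk]
    rfl
  · exact bdd_integrable (α := ℕ × (Fin K → ℕ)) _ _ fun x => hg _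

lemma EK_succ (l r : ℝ≥0) (K : ℕ) (z : ℕ → ℂ) (hz : ∀ k, ‖z k‖ ≤ 1) (q : ℕ) :
    EK l r (K + 1) z q = Pop l r (z 0) (EK l r K fun k => z (k + 1)) q := by
  have hW := WF_norm K (fun k => z (k + 1)) (fun k => hz _)
  have hW1 := WF_norm (K + 1) z hz
  rw [EK, integral_prod _ (bdd_integrable _ _ fun x => hW1 q x.1 x.2)]
  rw [integral_pi_succ K l _ fun x => norm_integral_le_one _ _ fun y => hW1 _ _ _]
  simp_rw [integral_pi_succ K r _ fun x => hW1 _ _ _]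
  unfold Pop
  congr 1; ext a
  rw [integral_integral_swap]
  · congr 1; ext s
    rw [EK, integral_prod _ (bdd_integrable _ _ fun x => hW _ x.1 x.2)]
    simp only [WF, Fin.cons_zero, Fin.cons_succ]
    simp_rw [integral_const_mul]
  · refine bdd_integrable _ _ fun x => ?_
    exact norm_integral_le_one _ _ fun y => hW1 _ _ _

lemma norm_exp_le_one (l : ℝ≥0) {z : ℂ} (hz : ‖z‖ ≤ 1) : ‖Complex.exp (l * (z - 1))‖ ≤ 1 := by
  rw [Complex.norm_exp, Real.exp_le_one_iff]
  have h1 : z.re ≤ 1 := (Complex.re_le_norm z).trans hz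
  have : ((l : ℂ) * (z - 1)).re = l * (z.re - 1) := by simp
  rw [this]
  nlinarith [NNReal.coe_nonneg l]

lemma EK_pi (l r : ℝ≥0) (hlr : l < r) (hl : 2 * (l : ℝ) ≤ 1) {x : ℝ} (hx : x * r = l) (K : ℕ) :
    ∀ (z : ℕ → ℂ) (_ : ∀ k, ‖z k‖ ≤ 1),
    ‖∑' q, (gw x q : ℂ) * EK l r K z q
      - Complex.exp (∑ k ∈ Finset.range K, l * (z k - 1))‖ ≤ K * (9 * ((l : ℝ) + r) ^ 2) := by
  have hr : (0 : ℝ) < r := lt_of_le_of_lt l.2 (by exact_mod_cast hlr)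
  have hx' : x = l / r := by field_simp; linarith
  have h0 : 0 ≤ x := by rw [hx']; positivity
  have h1 : x < 1 := by rw [hx', div_lt_one hr]; exact_mod_cast hlr
  induction K with
  | zero =>
    intro z hz
    have : ∀ q, EK l r 0 z q = 1 := fun q => by simp [EK, WF]
    simp only [this, mul_one, Finset.range_zero, Finset.sum_empty, Complex.exp_zero]
    rw [← Complex.ofReal_tsum, (gw_hasSum h0 h1).tsum_eq]
    simp
  | succ K ih =>
    intro z hz
    have hz' : ∀ k, ‖z (k + 1)‖ ≤ 1 := fun k => hz _
    have i1 := ih (fun k => z (k + 1)) hz'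
    have i2 := Pop_pi l r hlr hl (hz 0) (EK_norm l r K _ hz') hx
    simp_rw [EK_succ l r K z hz]
    rw [Finset.sum_range_succ', Complex.exp_add]
    have i3 := norm_exp_le_one l (hz 0)
    set p := ∑' q, (gw x q : ℂ) * EK l r K (fun k => z (k + 1)) q
    set e := Complex.exp (l * (z 0 - 1))
    set E := Complex.exp (∑ k ∈ Finset.range K, l * (z (k + 1) - 1))
    set pp := ∑' q, (gw x q : ℂ) * Pop l r (z 0) (EK l r K (fun k => z (k + 1))) q
    have : pp - E * e = (pp - e * p) + e * (p - E) := by ring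
    rw [this]
    refine (norm_add_le _ _).trans ?_
    rw [norm_mul]
    have := mul_le_of_le_one_left (norm_nonneg (p - E)) i3
    push_cast
    nlinarith

/-- discrete queue recursion -/
def Qd (q : ℕ) (a s : ℕ → ℕ) : ℕ → ℕ
  | 0 => q
  | k + 1 => Qd q a s k + a k - s k

lemma Qd_succ' (q : ℕ) (a s : ℕ → ℕ) (k : ℕ) :
    Qd q a s (k + 1) = Qd (q + a 0 - s 0) (fun i => a (i + 1)) (fun i => s (i + 1)) k := by
  induction k with
  | zero => rfl
  | succ k ih => rw [Qd, ih]; rfl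

lemma WF_eq (K : ℕ) : ∀ (z : ℕ → ℂ) (q : ℕ) (a s : ℕ → ℕ),
    WF K z q (fun i => a i) (fun i => s i)
      = ∏ k ∈ Finset.range K, z k ^ (min (Qd q a s k + a k) (s k)) := by
  induction K with
  | zero => intro z q a s; simp [WF]
  | succ K ih =>
    intro z q a s
    rw [WF, Finset.prod_range_succ']
    simp only [Fin.val_zero, Fin.val_succ]
    rw [ih _ _ (fun i => a (i + 1)) (fun i => s (i + 1)), mul_comm]
    simp_rw [Qd_succ']
    rfl


/-- number of points in a half-open interval -/
abbrev cnt (B : Set ℝ) (a b : ℝ) : ℕ := (B ∩ Set.Ioc a b).ncard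

lemma LocFin.fin_Ioc {B : Set ℝ} (h : LocFin B) (a b : ℝ) : (B ∩ Set.Ioc a b).Finite :=
  (h a b).subset (inter_subset_inter_right _ Ioc_subset_Icc_self)

lemma LocFin.mono {B C : Set ℝ} (h : LocFin B) (hC : C ⊆ B) : LocFin C := fun a b =>
  (h a b).subset (inter_subset_inter_left _ hC)

lemma cnt_add {B : Set ℝ} (h : LocFin B) {a b c : ℝ} (hab : a ≤ b) (hbc : b ≤ c) :
    cnt B a c = cnt B a b + cnt B b c := by
  unfold cnt
  rw [← Ioc_union_Ioc_eq_Ioc hab hbc, inter_union_distrib_left]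
  refine ncard_union_eq ?_ (h.fin_Ioc a b) (h.fin_Ioc b c)
  refine Set.disjoint_left.2 fun x hx hy => ?_
  exact absurd hx.2.2 (not_le.2 hy.2.1)

lemma Z_incr {A S : Set ℝ} (hA : LocFin A) (hS : LocFin S) {r s : ℝ} (h : r ≤ s) :
    Zfun A S s - Zfun A S r = (cnt A r s : ℤ) - cnt S r s := by
  unfold Zfun
  split_ifs with h1 h2 h2
  · have e1 := cnt_add hA h2 h
    have e2 := cnt_add hS h2 h
    unfold cnt at *; omega
  · have e1 := cnt_add hA (not_le.1 h2).le h1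
    have e2 := cnt_add hS (not_le.1 h2).le h1
    unfold cnt at *; omega
  · exact absurd (h2.trans h) h1
  · have e1 := cnt_add hA h (not_le.1 h1).le
    have e2 := cnt_add hS h (not_le.1 h1).le
    unfold cnt at *; omega

lemma cnt_pos {B : Set ℝ} (h : LocFin B) {a b x : ℝ} (hx : x ∈ B) (h1 : a < x) (h2 : x ≤ b) :
    1 ≤ cnt B a b :=
  (ncard_pos (h.fin_Ioc a b)).2 ⟨x, hx, h1, h2⟩

lemma Dep_sub (A S : Set ℝ) : Dep A S ⊆ S := sdiff_subset

lemma mem_Dep {A S : Set ℝ} {r : ℝ} (hr : r ∈ S) :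
    r ∈ Dep A S ↔ ∃ r' < r, Zfun A S r' ≤ Zfun A S r := by
  unfold Dep Unused
  constructor
  · rintro ⟨h1, h2⟩
    by_contra! h
    exact h2 ⟨h1, h⟩
  · rintro ⟨r', h1, h2⟩
    exact ⟨hr, fun h => absurd (h.2 r' h1) (not_lt.2 h2)⟩

lemma exists_cell (t : ℕ → ℝ) (K : ℕ) {x : ℝ} (h0 : t 0 < x) (hK : x ≤ t K) :
    ∃ j < K, t j < x ∧ x ≤ t (j + 1) := by
  induction K with
  | zero => exact absurd h0 (not_lt.2 hK)
  | succ K ih =>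
    by_cases h : x ≤ t K
    · obtain ⟨j, hj, h'⟩ := ih h
      exact ⟨j, by omega, h'⟩
    · exact ⟨K, by omega, not_le.1 h, hK⟩

section path

/-- discrete queue along a grid -/
def Qg (A S : Set ℝ) (t : ℕ → ℝ) (q : ℕ) : ℕ → ℕ :=
  Qd q (fun k => cnt A (t k) (t (k + 1))) (fun k => cnt S (t k) (t (k + 1)))

/-- discrete departures along a grid -/
def dg (A S : Set ℝ) (t : ℕ → ℝ) (q k : ℕ) : ℕ :=
  min (Qg A S t q k + cnt A (t k) (t (k + 1))) (cnt S (t k) (t (k + 1)))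

lemma b_succ {A S : Set ℝ} (hA : LocFin A) (hS : LocFin S) {t : ℕ → ℝ} (ht : StrictMono t)
    (q k : ℕ) :
    Zfun A S (t (k + 1)) - Qg A S t q (k + 1)
      = min (Zfun A S (t k) - Qg A S t q k) (Zfun A S (t (k + 1))) := by
  have := Z_incr hA hS (ht (Nat.lt_succ_self k)).le
  have e : Qg A S t q (k + 1) = Qg A S t q k + cnt A (t k) (t (k + 1)) - cnt S (t k) (t (k + 1)) :=
    rfl
  simp only [Nat.succ_eq_add_one] at this
  omega

lemma b_le {A S : Set ℝ} (hA : LocFin A) (hS : LocFin S) {t : ℕ → ℝ} (ht : StrictMono t)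
    (q k : ℕ) : ∀ j ≤ k, Zfun A S (t k) - Qg A S t q k ≤ Zfun A S (t j) := by
  induction k with
  | zero => intro j hj; obtain rfl : j = 0 := by omega
            omega
  | succ k ih =>
    intro j hj
    rw [b_succ hA hS ht]
    rcases Nat.lt_or_ge k j with h | h
    · obtain rfl : j = k + 1 := by omega
      exact min_le_right _ _
    · exact (min_le_left _ _).trans (ih j h)

lemma b_cases {A S : Set ℝ} (hA : LocFin A) (hS : LocFin S) {t : ℕ → ℝ} (ht : StrictMono t)
    (q k : ℕ) : Zfun A S (t k) - Qg A S t q k = Zfun A S (t 0) - q ∨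
      ∃ j ≤ k, Zfun A S (t k) - Qg A S t q k = Zfun A S (t j) := by
  induction k with
  | zero => left; rfl
  | succ k ih =>
    rw [b_succ hA hS ht]
    rcases min_choice (Zfun A S (t k) - Qg A S t q k) (Zfun A S (t (k + 1))) with h | h
    · rw [h]
      rcases ih with h' | ⟨j, hj, h'⟩
      · left; exact h'
      · right; exact ⟨j, by omega, h'⟩
    · rw [h]; right; exact ⟨k + 1, le_rfl, rfl⟩

lemma path_cell {A S : Set ℝ} (hA : LocFin A) (hS : LocFin S) {t : ℕ → ℝ} (ht : StrictMono t)
    (q j0 k : ℕ) (hj : j0 ≤ k)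
    (sep : ∀ j ≤ k, cnt A (t j) (t (j + 1)) + cnt S (t j) (t (j + 1)) ≤ 1)
    (H : ∀ r' ≤ t 0, Zfun A S (t j0) ≤ Zfun A S r' - q) :
    dg A S t q k = cnt (Dep A S) (t k) (t (k + 1)) := by
  have hD : LocFin (Dep A S) := hS.mono (Dep_sub A S)
  have hle : cnt (Dep A S) (t k) (t (k + 1)) ≤ cnt S (t k) (t (k + 1)) :=
    ncard_le_ncard (inter_subset_inter_left _ (Dep_sub A S)) (hS.fin_Ioc _ _)
  have hsk := sep k le_rfl
  by_cases hs0 : cnt S (t k) (t (k + 1)) = 0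
  · unfold dg; omega
  have hs1 : cnt S (t k) (t (k + 1)) = 1 := by omega
  have ha0 : cnt A (t k) (t (k + 1)) = 0 := by omega
  obtain ⟨r, hr⟩ := ncard_eq_one.1 hs1
  have hrm : r ∈ S ∩ Ioc (t k) (t (k + 1)) := by rw [hr]; rfl
  obtain ⟨hrS, hr1, hr2⟩ := hrm
  have a1 := cnt_add hA hr1.le hr2
  have s1 := cnt_add hS hr1.le hr2
  have s2 := cnt_pos hS hrS hr1 le_rfl
  have z1 := Z_incr hA hS hr1.le
  have hZr : Zfun A S r = Zfun A S (t k) - 1 := by omega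
  have hiff : r ∈ Dep A S ↔ 1 ≤ Qg A S t q k := by
    rw [mem_Dep hrS]
    constructor
    · rintro ⟨r', h1, h2⟩
      have hb := b_le hA hS ht q k
      rcases le_or_gt r' (t 0) with h3 | h3
      · have := H r' h3
        have := hb j0 hj
        omega
      · rcases le_or_gt r' (t k) with h4 | h4
        · obtain ⟨j, hjk, h5, h6⟩ := exists_cell t k h3 h4
          have c1 := cnt_add hA h5.le h6
          have c2 := cnt_add hS h5.le h6
          have z2 := Z_incr hA hS h5.le
          have z3 := Z_incr hA hS h6
          have := sep j hjk.le
          have := hb j hjk.le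
          have := hb (j + 1) hjk
          omega
        · have c2 := cnt_add hS h4.le h1.le
          have c3 := cnt_pos hS hrS h1 le_rfl
          have z2 := Z_incr hA hS h4.le
          omega
    · intro hQ
      rcases b_cases hA hS ht q k with h | ⟨j, hj', h⟩
      · refine ⟨t j0, (ht.monotone hj).trans_lt hr1, ?_⟩
        have := H (t 0) le_rfl
        omega
      · refine ⟨t j, (ht.monotone hj').trans_lt hr1, ?_⟩
        omega
  by_cases hrD : r ∈ Dep A S
  · have := cnt_pos hD hrD hr1 hr2
    have := hiff.1 hrD
    unfold dg; omega
  · have : cnt (Dep A S) (t k) (t (k + 1)) = 0 := by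
      rw [cnt, ncard_eq_zero (hD.fin_Ioc _ _)]
      ext x
      simp only [mem_inter_iff, mem_empty_iff_false, iff_false]
      rintro ⟨h1, h2⟩
      have : x ∈ S ∩ Ioc (t k) (t (k + 1)) := ⟨Dep_sub _ _ h1, h2⟩
      rw [hr] at this
      rw [mem_singleton_iff.1 this] at h1
      exact hrD h1
    have := mt hiff.2 hrD
    unfold dg; omega

/-- sum of `θ` over a configuration -/
def Sm (θ : ℝ → ℝ) (D : Set ℝ) : ℝ := ∑ᶠ x ∈ D, θ x

lemma finsum_cells {D : Set ℝ} (hD : LocFin D) (θ : ℝ → ℝ) {t : ℕ → ℝ} (ht : StrictMono t) (K : ℕ)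
    (hθ : ∀ k < K, ∀ x ∈ Ioc (t k) (t (k + 1)), θ x = θ (t (k + 1))) :
    ∑ᶠ x ∈ D ∩ Ioc (t 0) (t K), θ x
      = ∑ k ∈ Finset.range K, θ (t (k + 1)) * cnt D (t k) (t (k + 1)) := by
  induction K with
  | zero => simp
  | succ K ih =>
    rw [Finset.sum_range_succ, ← ih fun k hk => hθ k (by omega),
      ← Ioc_union_Ioc_eq_Ioc (ht.monotone (Nat.zero_le K)) (ht (Nat.lt_succ_self K)).le,
      inter_union_distrib_left, finsum_mem_union _ (hD.fin_Ioc _ _) (hD.fin_Ioc _ _)]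
    · congr 1
      rw [finsum_mem_congr rfl (fun x hx => hθ K (by omega) x hx.2)]
      rw [finsum_mem_eq_finite_toFinset_sum _ (hD.fin_Ioc _ _), Finset.sum_const,
        nsmul_eq_mul, mul_comm, ← ncard_eq_toFinset_card _ (hD.fin_Ioc _ _)]
    · refine Set.disjoint_left.2 fun x hx hy => ?_
      exact absurd hx.2.2 (not_le.2 hy.2.1)

lemma Sm_inter (θ : ℝ → ℝ) (D I : Set ℝ) (h : ∀ x ∉ I, θ x = 0) :
    Sm θ D = ∑ᶠ x ∈ D ∩ I, θ x := by
  unfold Sm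
  refine finsum_mem_inter_support_eq _ _ _ ?_
  ext x
  simp only [mem_inter_iff, Function.mem_support]
  constructor
  · rintro ⟨h1, h2⟩
    exact ⟨⟨h1, by by_contra h3; exact h2 (h x h3)⟩, h2⟩
  · rintro ⟨⟨h1, _⟩, h2⟩; exact ⟨h1, h2⟩

lemma path_sum {A S : Set ℝ} (hA : LocFin A) (hS : LocFin S) {t : ℕ → ℝ} (ht : StrictMono t)
    (q j0 K : ℕ)
    (sep : ∀ j < K, cnt A (t j) (t (j + 1)) + cnt S (t j) (t (j + 1)) ≤ 1)
    (H : ∀ r' ≤ t 0, Zfun A S (t j0) ≤ Zfun A S r' - q) (θ : ℝ → ℝ)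
    (hθ : ∀ k < K, ∀ x ∈ Ioc (t k) (t (k + 1)), θ x = θ (t (k + 1)))
    (hθ0 : ∀ x ∉ Ioc (t j0) (t K), θ x = 0) :
    ∑ k ∈ Finset.range K, θ (t (k + 1)) * dg A S t q k = Sm θ (Dep A S) := by
  have hD : LocFin (Dep A S) := hS.mono (Dep_sub A S)
  rw [Sm_inter θ _ (Ioc (t 0) (t K)), finsum_cells hD θ ht K hθ]
  · refine Finset.sum_congr rfl fun k hk => ?_
    rw [Finset.mem_range] at hk
    rcases Nat.lt_or_ge k j0 with h | h
    · rw [hθ0 (t (k + 1))]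
      · simp
      · intro hm
        exact absurd hm.1 (not_lt.2 (ht.monotone h))
    · rw [path_cell hA hS ht q j0 k h (fun j hj => sep j (by omega)) H]
  · intro x hx
    refine hθ0 x fun hm => hx ⟨(ht.monotone (Nat.zero_le _)).trans_lt hm.1, hm.2⟩

end path


lemma pois_mean_hasSum (r : ℝ≥0) :
    HasSum (fun n : ℕ => Real.exp (-r) * r ^ n / (n.factorial) * (n : ℝ)) r := by
  rw [← hasSum_nat_add_iff' 1]
  simp only [Finset.range_one, Finset.sum_singleton, Nat.cast_zero, mul_zero, sub_zero]
  have h := (hasSum_one_poissonMeasure r).mul_left (r : ℝ)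
  rw [mul_one] at h
  convert! h using 1
  ext n
  rw [Nat.factorial_succ]
  push_cast
  have : (n.factorial : ℝ) ≠ 0 := by positivity
  field_simp
  ring

lemma pois_mean (r : ℝ≥0) : ∫ n : ℕ, (n : ℝ) ∂(poissonMeasure r) = r := by
  rw [integral_poissonMeasure]
  exact (pois_mean_hasSum r).tsum_eq

lemma pois_mean_int (r : ℝ≥0) : Integrable (fun n : ℕ => (n : ℝ)) (poissonMeasure r) := by
  rw [integrable_poissonMeasure_iff]
  simpa using (pois_mean_hasSum r).summable

section PPbasic
variable {Ω : Type*} [MeasurableSpace Ω] {P : Measure Ω}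
  {X : Ω → Set ℝ} {μ : ℝ≥0}

lemma PP_map (h : IsPoissonPP P X μ) {B : Set ℝ} (hm : MeasurableSet B)
    (hb : Bornology.IsBounded B) :
    Measure.map (fun ω => (X ω ∩ B).ncard) P = poissonMeasure (μ * (volume B).toNNReal) :=
  (h.2 1 (fun _ => B) (fun _ => hm) (fun _ => hb)
    (fun i j hij => absurd (Subsingleton.elim i j) hij)).2 0

lemma PP_aem (h : IsPoissonPP P X μ) {B : Set ℝ} (hm : MeasurableSet B)
    (hb : Bornology.IsBounded B) : AEMeasurable (fun ω => (X ω ∩ B).ncard) P := by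
  by_contra hc
  have := PP_map h hm hb
  rw [Measure.map_of_not_aemeasurable hc] at this
  exact IsProbabilityMeasure.ne_zero (poissonMeasure (μ * (volume B).toNNReal)) this.symm

lemma PP_real (h : IsPoissonPP P X μ) {B : Set ℝ} (hm : MeasurableSet B)
    (hb : Bornology.IsBounded B) (s : Set ℕ) :
    P.real {ω | (X ω ∩ B).ncard ∈ s} = (poissonMeasure (μ * (volume B).toNNReal)).real s := by
  rw [← PP_map h hm hb, measureReal_def, measureReal_def,
    Measure.map_apply_of_aemeasurable (PP_aem h hm hb) (MeasurableSet.of_discrete)]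
  rfl

lemma PP_ge1 (h : IsPoissonPP P X μ) {B : Set ℝ} (hm : MeasurableSet B)
    (hb : Bornology.IsBounded B) :
    P.real {ω | 1 ≤ (X ω ∩ B).ncard} ≤ μ * volume.real B := by
  refine (PP_real h hm hb {n | 1 ≤ n}).trans_le ((pois_ge1 _).trans ?_)
  push_cast; rfl

lemma PP_ge2 (h : IsPoissonPP P X μ) {B : Set ℝ} (hm : MeasurableSet B)
    (hb : Bornology.IsBounded B) :
    P.real {ω | 2 ≤ (X ω ∩ B).ncard} ≤ (μ * volume.real B) ^ 2 := by
  refine (PP_real h hm hb {n | 2 ≤ n}).trans_le ((pois_ge2 _).trans ?_)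
  push_cast; rfl

lemma PP_slln (h : IsPoissonPP P X μ) (e : ℕ → Set ℝ) (hm : ∀ i, MeasurableSet (e i))
    (hb : ∀ i, Bornology.IsBounded (e i)) (hd : Pairwise fun i j => Disjoint (e i) (e j))
    (hv : ∀ i, volume (e i) = 1) :
    ∀ᵐ ω ∂P, Tendsto (fun n : ℕ => (∑ i ∈ Finset.range n, ((X ω ∩ e i).ncard : ℝ)) / n)
      atTop (nhds (μ : ℝ)) := by
  have hmap : ∀ i, Measure.map (fun ω => (X ω ∩ e i).ncard) P = poissonMeasure μ := fun i => by
    rw [PP_map h (hm i) (hb i), hv i]; simp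
  have haem := fun i => PP_aem h (hm i) (hb i)
  have hcast : Measurable (fun n : ℕ => (n : ℝ)) := Measurable.of_discrete
  have := strong_law_ae_real (μ := P) (fun i ω => ((X ω ∩ e i).ncard : ℝ)) ?_ ?_ ?_
  · have hE : ∫ ω, ((X ω ∩ e 0).ncard : ℝ) ∂P = μ := by
      rw [← pois_mean μ, ← hmap 0, integral_map (haem 0) hcast.aestronglyMeasurable]
    rw [hE] at this
    exact this
  · have := pois_mean_int μ
    rw [← hmap 0] at this
    exact this.comp_aemeasurable (haem 0)
  · intro i j hij
    have h2 := (h.2 2 ![e i, e j] (by intro k; fin_cases k <;> simp [hm])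
      (by intro k; fin_cases k <;> simp [hb]) (by
        intro k l hkl
        fin_cases k <;> fin_cases l <;> first | exact absurd rfl hkl | skip
        · exact hd hij
        · exact hd hij.symm)).1
    have h3 := h2.indepFun (show (0 : Fin 2) ≠ 1 by decide)
    exact h3.comp hcast hcast
  · intro i
    refine ⟨hcast.comp_aemeasurable (haem i), hcast.comp_aemeasurable (haem 0), ?_⟩
    have hh : ∀ i, Measure.map (fun ω => ((X ω ∩ e i).ncard : ℝ)) P
        = Measure.map (fun n : ℕ => (n : ℝ)) (poissonMeasure μ) := fun i => by
      rw [← hmap i, AEMeasurable.map_map_of_aemeasurable hcast.aemeasurable (haem i)]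
      rfl
    rw [hh, hh]

lemma sum_cnt_pos {B : Set ℝ} (hB : LocFin B) (n : ℕ) :
    ∑ i ∈ Finset.range n, (B ∩ Ioc (i : ℝ) (i + 1)).ncard = cnt B 0 n := by
  induction n with
  | zero => simp [cnt]
  | succ n ih =>
    rw [Finset.sum_range_succ, ih, cnt_add hB (c := ((n + 1 : ℕ) : ℝ)) (b := (n : ℝ)) (by positivity)
      (by push_cast; linarith)]
    simp

lemma sum_cnt_neg {B : Set ℝ} (hB : LocFin B) (n : ℕ) :
    ∑ i ∈ Finset.range n, (B ∩ Ioc (-((i : ℝ) + 1)) (-(i : ℝ))).ncard = cnt B (-(n : ℝ)) 0 := by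
  induction n with
  | zero => simp [cnt]
  | succ n ih =>
    rw [Finset.sum_range_succ, ih, cnt_add hB (a := -((n + 1 : ℕ) : ℝ)) (b := -(n : ℝ))
      (by push_cast; linarith) (by simp), add_comm]
    simp

lemma drift {u v : ℕ → ℕ} {l r : ℝ} (hlr : l < r)
    (hu : Tendsto (fun n : ℕ => (u n : ℝ) / n) atTop (nhds l))
    (hv : Tendsto (fun n : ℕ => (v n : ℝ) / n) atTop (nhds r)) :
    Tendsto (fun n : ℕ => (v n : ℤ) - u (n + 1)) atTop atTop := by
  have hu' := hu.comp (tendsto_add_atTop_nat 1)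
  set ε := (r - l) / 3 with hε
  have e0 : 0 < ε := by rw [hε]; linarith
  have e1 := hu'.eventually (gt_mem_nhds (show l < l + ε by linarith))
  have e2 := hv.eventually (lt_mem_nhds (show r - ε < r by linarith))
  have hlin : Tendsto (fun n : ℕ => ε * (n : ℝ) - (l + ε)) atTop atTop :=
    tendsto_atTop_add_const_right _ _
      (tendsto_natCast_atTop_atTop.const_mul_atTop e0)
  rw [← tendsto_intCast_atTop_iff (R := ℝ)]
  refine tendsto_atTop_mono' _ ?_ hlin
  filter_upwards [e1, e2, eventually_gt_atTop 0] with n h1 h2 h3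
  have hn : (0 : ℝ) < n := by exact_mod_cast h3
  simp only [Function.comp] at h1
  rw [div_lt_iff₀ (by positivity)] at h1
  rw [lt_div_iff₀ hn] at h2
  push_cast at h1 ⊢
  nlinarith

lemma cnt_mono {B : Set ℝ} (hB : LocFin B) {a b c d : ℝ} (h1 : c ≤ a) (h2 : b ≤ d) :
    cnt B a b ≤ cnt B c d :=
  ncard_le_ncard (inter_subset_inter_right _ (Ioc_subset_Ioc h1 h2)) (hB.fin_Ioc _ _)

lemma admissible_of {A S : Set ℝ} (hA : LocFin A) (hS : LocFin S) (hd : Disjoint A S) {l r : ℝ}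
    (hlr : l < r)
    (h1 : Tendsto (fun n : ℕ => (cnt A 0 n : ℝ) / n) atTop (nhds l))
    (h2 : Tendsto (fun n : ℕ => (cnt S 0 n : ℝ) / n) atTop (nhds r))
    (h3 : Tendsto (fun n : ℕ => (cnt A (-(n : ℝ)) 0 : ℝ) / n) atTop (nhds l))
    (h4 : Tendsto (fun n : ℕ => (cnt S (-(n : ℝ)) 0 : ℝ) / n) atTop (nhds r)) :
    Admissible A S := by
  refine ⟨hA, hS, hd, ?_, ?_⟩
  · have d := (drift hlr h1 h2).comp (tendsto_nat_floor_atTop (α := ℝ))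
    have d' := tendsto_neg_atTop_atBot.comp d
    refine tendsto_atBot_mono' _ ?_ d'
    filter_upwards [eventually_ge_atTop 0] with x hx
    simp only [Function.comp, Zfun, if_pos hx]
    have f1 := Nat.floor_le hx
    have f2 := Nat.lt_floor_add_one x
    have c1 : cnt A 0 x ≤ cnt A 0 (⌊x⌋₊ + 1 : ℕ) := cnt_mono hA le_rfl (by push_cast; exact f2.le)
    have c2 : cnt S 0 ⌊x⌋₊ ≤ cnt S 0 x := cnt_mono hS le_rfl f1
    unfold cnt at *
    omega
  · have d := ((drift hlr h3 h4).comp (tendsto_nat_floor_atTop (α := ℝ))).comp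
      tendsto_neg_atBot_atTop
    refine tendsto_atTop_mono' _ ?_ d
    filter_upwards [eventually_lt_atBot 0] with x hx
    simp only [Function.comp, Zfun, if_neg (not_le.2 hx)]
    have f1 := Nat.floor_le (show 0 ≤ -x by linarith)
    have f2 := Nat.lt_floor_add_one (-x)
    have c1 : cnt A x 0 ≤ cnt A (-((⌊-x⌋₊ + 1 : ℕ) : ℝ)) 0 :=
      cnt_mono hA (by push_cast; linarith) le_rfl
    have c2 : cnt S (-(⌊-x⌋₊ : ℝ)) 0 ≤ cnt S x 0 := cnt_mono hS (by linarith) le_rfl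
    unfold cnt at *
    omega

lemma PP_slln_pos (h : IsPoissonPP P X μ) :
    ∀ᵐ ω ∂P, Tendsto (fun n : ℕ => (cnt (X ω) 0 n : ℝ) / n) atTop (nhds (μ : ℝ)) := by
  filter_upwards [h.1, PP_slln h (fun i : ℕ => Ioc (i : ℝ) (i + 1)) (fun i => measurableSet_Ioc)
    (fun i => Metric.isBounded_Ioc _ _) (fun i j hij => by
      refine Set.disjoint_left.2 fun x hx hy => ?_
      simp only [mem_Ioc] at hx hy
      rcases lt_or_gt_of_ne hij with h | h
      · have : (i : ℝ) + 1 ≤ j := by exact_mod_cast h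
        linarith
      · have : (j : ℝ) + 1 ≤ i := by exact_mod_cast h
        linarith) (by intro i; simp)] with ω h1 h2
  convert! h2 using 3 with n
  rw [← sum_cnt_pos h1]; push_cast; rfl

lemma PP_slln_neg (h : IsPoissonPP P X μ) :
    ∀ᵐ ω ∂P, Tendsto (fun n : ℕ => (cnt (X ω) (-(n : ℝ)) 0 : ℝ) / n) atTop (nhds (μ : ℝ)) := by
  filter_upwards [h.1, PP_slln h (fun i : ℕ => Ioc (-((i : ℝ) + 1)) (-(i : ℝ)))
    (fun i => measurableSet_Ioc)
    (fun i => Metric.isBounded_Ioc _ _) (fun i j hij => by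
      refine Set.disjoint_left.2 fun x hx hy => ?_
      simp only [mem_Ioc] at hx hy
      rcases lt_or_gt_of_ne hij with h | h
      · have : (i : ℝ) + 1 ≤ j := by exact_mod_cast h
        linarith
      · have : (j : ℝ) + 1 ≤ i := by exact_mod_cast h
        linarith) (by intro i; simp)] with ω h1 h2
  convert! h2 using 3 with n
  rw [← sum_cnt_neg h1]; push_cast; rfl

end PPbasic


/-- dyadic grid -/
def tg (n k : ℕ) : ℝ := -(n : ℝ) + k * (1 / 2) ^ n

lemma tg_mono (n : ℕ) : StrictMono (tg n) := by
  refine strictMono_nat_of_lt_succ fun k => ?_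
  unfold tg
  have : (0 : ℝ) < (1 / 2) ^ n := by positivity
  push_cast; nlinarith

lemma tg_zero (n : ℕ) : tg n 0 = -(n : ℝ) := by simp [tg]

lemma tg_end (n T : ℕ) : tg n ((n + T) * 2 ^ n) = T := by
  simp only [tg]; push_cast
  rw [mul_assoc, ← mul_pow]; norm_num

lemma tg_mid (n T : ℕ) (h : T ≤ n) : tg n ((n - T) * 2 ^ n) = -(T : ℝ) := by
  simp only [tg]; push_cast [Nat.cast_sub h]
  rw [mul_assoc, ← mul_pow]; norm_num; ring

lemma tg_sub (n k : ℕ) : tg n (k + 1) - tg n k = (1 / 2) ^ n := by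
  simp only [tg]; push_cast; ring

lemma tg_vol (n k : ℕ) : (volume (Ioc (tg n k) (tg n (k + 1)))).toNNReal = (1 / 2) ^ n := by
  rw [Real.volume_Ioc, tg_sub]
  rw [ENNReal.ofReal, ENNReal.toNNReal_coe]
  ext; rw [Real.coe_toNNReal _ (by positivity)]; push_cast; rfl

lemma tg_volr (n k : ℕ) : volume.real (Ioc (tg n k) (tg n (k + 1))) = (1 / 2) ^ n := by
  rw [Real.volume_real_Ioc_of_le ((tg_mono n) (Nat.lt_succ_self k)).le, tg_sub]

lemma tg_disj (n : ℕ) : Pairwise fun i j =>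
    Disjoint (Ioc (tg n i) (tg n (i + 1))) (Ioc (tg n j) (tg n (j + 1))) := by
  intro i j hij
  refine Set.disjoint_left.2 fun x hx hy => ?_
  simp only [mem_Ioc] at hx hy
  rcases lt_or_gt_of_ne hij with h | h
  · have := (tg_mono n).monotone (show i + 1 ≤ j from h)
    linarith
  · have := (tg_mono n).monotone (show j + 1 ≤ i from h)
    linarith

lemma meas_count {B : Set ℝ} (hm : MeasurableSet B) (hb : Bornology.IsBounded B) :
    @Measurable _ _ pointMS _ (fun x : Set ℝ => (x ∩ B).ncard) := by
  letI : MeasurableSpace (Set ℝ) := pointMS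
  refine measurable_to_countable' fun n => ?_
  exact MeasurableSpace.measurableSet_generateFrom ⟨B, n, hm, hb, rfl⟩

section stage1
variable {Ω : Type*} [MeasurableSpace Ω] {P : Measure Ω} [IsProbabilityMeasure P]
    {A S : Ω → Set ℝ} {lam rho : ℝ≥0}

lemma bad_cell (hA : IsPoissonPP P A lam) (hS : IsPoissonPP P S rho) (hi : PPIndep P A S)
    (n k : ℕ) :
    P {ω | 2 ≤ cnt (A ω) (tg n k) (tg n (k + 1)) + cnt (S ω) (tg n k) (tg n (k + 1))}
      ≤ ENNReal.ofReal (((lam : ℝ) + rho) ^ 2 * ((1 / 2) ^ n) ^ 2) := by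
  set B := Ioc (tg n k) (tg n (k + 1)) with hB
  have hm : MeasurableSet B := measurableSet_Ioc
  have hb : Bornology.IsBounded B := Metric.isBounded_Ioc _ _
  have hv : volume.real B = (1 / 2) ^ n := tg_volr n k
  have a1 := PP_ge1 hA hm hb
  have a2 := PP_ge2 hA hm hb
  have s1 := PP_ge1 hS hm hb
  have s2 := PP_ge2 hS hm hb
  rw [hv] at a1 a2 s1 s2
  have hsub : {ω | 2 ≤ cnt (A ω) (tg n k) (tg n (k + 1)) + cnt (S ω) (tg n k) (tg n (k + 1))}
      ⊆ ({ω | 2 ≤ (A ω ∩ B).ncard} ∪ {ω | 2 ≤ (S ω ∩ B).ncard})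
        ∪ ({ω | 1 ≤ (A ω ∩ B).ncard} ∩ {ω | 1 ≤ (S ω ∩ B).ncard}) := by
    intro ω hω
    simp only [mem_union, mem_inter_iff, mem_ofPred_eq, cnt] at hω ⊢
    rw [← hB] at hω
    omega
  have hprod : P.real ({ω | 1 ≤ (A ω ∩ B).ncard} ∩ {ω | 1 ≤ (S ω ∩ B).ncard})
      = P.real {ω | 1 ≤ (A ω ∩ B).ncard} * P.real {ω | 1 ≤ (S ω ∩ B).ncard} := by
    have := hi.comp (φ := fun x : Set ℝ => (x ∩ B).ncard) (ψ := fun x : Set ℝ => (x ∩ B).ncard)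
      (meas_count hm hb) (meas_count hm hb)
    have := this.measure_inter_preimage_eq_mul {n | 1 ≤ n} {n | 1 ≤ n} MeasurableSet.of_discrete
      MeasurableSet.of_discrete
    simp only [measureReal_def]
    rw [← ENNReal.toReal_mul]
    exact congrArg _ this
  rw [← ofReal_measureReal]
  apply ENNReal.ofReal_le_ofReal
  refine (measureReal_mono hsub).trans ?_
  refine (measureReal_union_le _ _).trans ?_
  refine (add_le_add_left (measureReal_union_le _ _) _).trans ?_
  rw [hprod]
  set d : ℝ := (1 / 2) ^ n
  have hd : 0 ≤ d := by positivity
  have := mul_le_mul a1 s1 (measureReal_nonneg) (by positivity)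
  have l0 : (0 : ℝ) ≤ lam := lam.2
  have r0 : (0 : ℝ) ≤ rho := rho.2
  have : 0 ≤ lam * d * (rho * d) := by positivity
  nlinarith

lemma ae_sep (hA : IsPoissonPP P A lam) (hS : IsPoissonPP P S rho) (hi : PPIndep P A S)
    (T : ℕ) : ∀ᵐ ω ∂P, ∀ᶠ n in atTop, ∀ k < (n + T) * 2 ^ n,
      cnt (A ω) (tg n k) (tg n (k + 1)) + cnt (S ω) (tg n k) (tg n (k + 1)) ≤ 1 := by
  set c : ℝ := ((lam : ℝ) + rho) ^ 2
  let bad : ℕ → Set Ω := fun n => ⋃ k ∈ Finset.range ((n + T) * 2 ^ n),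
    {ω | 2 ≤ cnt (A ω) (tg n k) (tg n (k + 1)) + cnt (S ω) (tg n k) (tg n (k + 1))}
  have hbad : ∀ n, P (bad n) ≤ ENNReal.ofReal (((n : ℝ) + T) * (1 / 2) ^ n * c) := fun n => by
    refine (measure_biUnion_finset_le _ _).trans ?_
    refine (Finset.sum_le_sum fun k _ => bad_cell hA hS hi n k).trans ?_
    rw [Finset.sum_const, Finset.card_range, ← ENNReal.ofReal_nsmul]
    apply ENNReal.ofReal_le_ofReal
    rw [nsmul_eq_mul]; push_cast
    apply le_of_eq
    have : (2 : ℝ) ^ n * (1 / 2) ^ n = 1 := by rw [← mul_pow]; norm_num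
    linear_combination ((n : ℝ) + T) * c * (1 / 2) ^ n * this
  have hsum : Summable fun n : ℕ => ((n : ℝ) + T) * (1 / 2) ^ n * c := by
    apply Summable.mul_right
    have h1 : Summable fun n : ℕ => (n : ℝ) ^ 1 * (1 / 2 : ℝ) ^ n :=
      summable_pow_mul_geometric_of_norm_lt_one 1 (by norm_num)
    have h2 : Summable fun n : ℕ => (T : ℝ) * (1 / 2 : ℝ) ^ n :=
      (summable_geometric_two).mul_left _
    convert! h1.add h2 using 1
    ext n; simp; ring
  have hfin : ∑' n, P (bad n) ≠ ⊤ :=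
    ne_top_of_le_ne_top hsum.tsum_ofReal_ne_top (ENNReal.tsum_le_tsum hbad)
  filter_upwards [ae_eventually_notMem hfin] with ω hω
  filter_upwards [hω] with n hn k hk
  by_contra hc
  apply hn
  simp only [bad, mem_iUnion, Finset.mem_range]
  exact ⟨k, hk, by simp only [mem_ofPred_eq]; omega⟩

lemma ae_good (hlr : lam < rho)
    (hA : IsPoissonPP P A lam) (hS : IsPoissonPP P S rho) (hi : PPIndep P A S) :
    ∀ᵐ ω ∂P, Disjoint (A ω) (S ω) ∧ Admissible (A ω) (S ω) := by
  have hsep := ae_all_iff.2 (ae_sep hA hS hi)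
  filter_upwards [hA.1, hS.1, hsep, PP_slln_pos hA, PP_slln_pos hS, PP_slln_neg hA,
    PP_slln_neg hS] with ω h1 h2 h3 h4 h5 h6 h7
  have hd : Disjoint (A ω) (S ω) := by
    refine Set.disjoint_left.2 fun x hx hy => ?_
    obtain ⟨T, hT⟩ := exists_nat_ge |x|
    obtain ⟨n, hn, hnT⟩ := ((h3 T).and (eventually_gt_atTop T)).exists
    have hnT' : (T : ℝ) < n := by exact_mod_cast hnT
    have hx1 := neg_abs_le x
    have hx2 := le_abs_self x
    obtain ⟨j, hj, c1, c2⟩ := exists_cell (tg n) ((n + T) * 2 ^ n) (x := x)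
      (by rw [tg_zero]; linarith) (by rw [tg_end]; linarith)
    have := hn j hj
    have := cnt_pos h1 hx c1 c2
    have := cnt_pos h2 hy c1 c2
    omega
  exact ⟨hd, admissible_of h1 h2 hd (by exact_mod_cast hlr) h4 h5 h6 h7⟩

lemma law_vec {X : Ω → Set ℝ} {μ : ℝ≥0} (h : IsPoissonPP P X μ) (n K : ℕ) :
    P.map (fun ω (i : Fin K) => cnt (X ω) (tg n i) (tg n (i + 1)))
      = Measure.pi fun _ => poissonMeasure (μ * (1 / 2) ^ n) := by
  have hh := h.2 K (fun i => Ioc (tg n i) (tg n (i + 1))) (fun i => measurableSet_Ioc)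
    (fun i => Metric.isBounded_Ioc _ _) (fun i j hij => tg_disj n (fun h => hij (Fin.ext h)))
  have := (iIndepFun_iff_map_fun_eq_pi_map (fun i =>
    PP_aem h measurableSet_Ioc (Metric.isBounded_Ioc _ _))).1 hh.1
  rw [this]
  congr 1; ext1 i
  rw [hh.2 i, tg_vol]

lemma vec_aem {X : Ω → Set ℝ} {μ : ℝ≥0} (h : IsPoissonPP P X μ) (n K : ℕ) :
    AEMeasurable (fun ω (i : Fin K) => cnt (X ω) (tg n i) (tg n (i + 1))) P :=
  aemeasurable_pi_lambda _ fun i => PP_aem h measurableSet_Ioc (Metric.isBounded_Ioc _ _)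

lemma law_pair (hA : IsPoissonPP P A lam) (hS : IsPoissonPP P S rho) (hi : PPIndep P A S)
    (n K : ℕ) :
    P.map (fun ω => ((fun i : Fin K => cnt (A ω) (tg n i) (tg n (i + 1))),
        fun i : Fin K => cnt (S ω) (tg n i) (tg n (i + 1))))
      = (Measure.pi fun _ => poissonMeasure (lam * (1 / 2) ^ n)).prod
        (Measure.pi fun _ => poissonMeasure (rho * (1 / 2) ^ n)) := by
  rw [← law_vec hA n K, ← law_vec hS n K]
  refine (indepFun_iff_map_prod_eq_prod_map_map (vec_aem hA n K) (vec_aem hS n K)).1 ?_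
  let φ : Set ℝ → (Fin K → ℕ) := fun x i => (x ∩ Ioc (tg n i) (tg n (i + 1))).ncard
  have hφ : @Measurable _ _ pointMS _ φ := by
    letI : MeasurableSpace (Set ℝ) := pointMS
    exact measurable_pi_lambda _ fun i => meas_count measurableSet_Ioc (Metric.isBounded_Ioc _ _)
  exact hi.comp (φ := φ) (ψ := φ) hφ hφ

lemma E_prod (hA : IsPoissonPP P A lam) (hS : IsPoissonPP P S rho) (hi : PPIndep P A S)
    (n K : ℕ) (z : ℕ → ℂ) (q : ℕ) :
    ∫ ω, ∏ k ∈ Finset.range K, z k ^ dg (A ω) (S ω) (tg n) q k ∂P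
      = EK (lam * (1 / 2) ^ n) (rho * (1 / 2) ^ n) K z q := by
  rw [EK, ← law_pair hA hS hi n K, integral_map ((vec_aem hA n K).prodMk (vec_aem hS n K))
    (Measurable.of_discrete).aestronglyMeasurable]
  congr 1; ext ω
  exact (WF_eq K z q _ _).symm

lemma Qg_aem (hA : IsPoissonPP P A lam) (hS : IsPoissonPP P S rho) (n q k : ℕ) :
    AEMeasurable (fun ω => Qg (A ω) (S ω) (tg n) q k) P := by
  induction k with
  | zero => exact aemeasurable_const
  | succ k ih =>
    have a := PP_aem hA (B := Ioc (tg n k) (tg n (k + 1))) measurableSet_Ioc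
      (Metric.isBounded_Ioc _ _)
    have s := PP_aem hS (B := Ioc (tg n k) (tg n (k + 1))) measurableSet_Ioc
      (Metric.isBounded_Ioc _ _)
    exact (ih.add a).sub s

lemma dg_aem (hA : IsPoissonPP P A lam) (hS : IsPoissonPP P S rho) (n q k : ℕ) :
    AEMeasurable (fun ω => dg (A ω) (S ω) (tg n) q k) P := by
  have a := PP_aem hA (B := Ioc (tg n k) (tg n (k + 1))) measurableSet_Ioc
    (Metric.isBounded_Ioc _ _)
  have s := PP_aem hS (B := Ioc (tg n k) (tg n (k + 1))) measurableSet_Ioc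
    (Metric.isBounded_Ioc _ _)
  exact ((Qg_aem hA hS n q k).add a).min s

lemma ae_path (hlr : lam < rho)
    (hA : IsPoissonPP P A lam) (hS : IsPoissonPP P S rho) (hi : PPIndep P A S)
    (T m : ℕ) (θ : ℝ → ℝ)
    (hθ : ∀ n ≥ m, ∀ k, ∀ x ∈ Ioc (tg n k) (tg n (k + 1)), θ x = θ (tg n (k + 1)))
    (hθ0 : ∀ x ∉ Ioc (-(T : ℝ)) T, θ x = 0) (q : ℕ) :
    ∀ᵐ ω ∂P, ∀ᶠ n in atTop,
      ∑ k ∈ Finset.range ((n + T) * 2 ^ n), θ (tg n (k + 1)) * dg (A ω) (S ω) (tg n) q k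
        = Sm θ (Dep (A ω) (S ω)) := by
  filter_upwards [ae_good hlr hA hS hi, ae_sep hA hS hi T] with ω h1 h2
  obtain ⟨-, lA, lS, -, -, hZ⟩ := h1
  have h3 := hZ.eventually (eventually_ge_atTop (Zfun (A ω) (S ω) (-(T : ℝ)) + q))
  obtain ⟨R, hR⟩ := eventually_atBot.1 h3
  obtain ⟨N, hN⟩ := exists_nat_ge (-R)
  filter_upwards [h2, eventually_ge_atTop T, eventually_ge_atTop m, eventually_ge_atTop N]
    with n e1 e2 e3 e4
  refine path_sum lA lS (tg_mono n) q ((n - T) * 2 ^ n) _ e1 ?_ θ (fun k _ => hθ n e3 k) ?_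
  · intro r' hr'
    rw [tg_mid n T e2]
    rw [tg_zero] at hr'
    have : (N : ℝ) ≤ n := by exact_mod_cast e4
    have := hR r' (by linarith)
    omega
  · rw [tg_mid n T e2, tg_end]
    exact hθ0

end stage1


lemma riem {t : ℕ → ℝ} (ht : StrictMono t) (F : ℝ → ℂ)
    (hF : ∀ k, ∀ x ∈ Ioc (t k) (t (k + 1)), F x = F (t (k + 1))) (K : ℕ) :
    IntegrableOn F (Ioc (t 0) (t K)) ∧
    ∫ x in Ioc (t 0) (t K), F x
      = ∑ k ∈ Finset.range K, ((t (k + 1) - t k : ℝ) : ℂ) * F (t (k + 1)) := by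
  induction K with
  | zero => simp
  | succ K ih =>
    have hle := ht.monotone (Nat.zero_le K)
    have hle2 := ht.monotone (Nat.le_succ K)
    have hu : Ioc (t 0) (t (K + 1)) = Ioc (t 0) (t K) ∪ Ioc (t K) (t (K + 1)) :=
      (Ioc_union_Ioc_eq_Ioc hle hle2).symm
    have hi : IntegrableOn F (Ioc (t K) (t (K + 1))) := by
      refine IntegrableOn.congr_fun (f := fun _ => F (t (K + 1))) ?_
        (fun x hx => (hF K x hx).symm) measurableSet_Ioc
      exact integrableOn_const (by simp)
    refine ⟨by rw [hu]; exact ih.1.union hi, ?_⟩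
    rw [hu, setIntegral_union (Ioc_disjoint_Ioc_of_le le_rfl) measurableSet_Ioc ih.1 hi, ih.2,
      Finset.sum_range_succ]
    congr 1
    rw [setIntegral_congr_fun measurableSet_Ioc (hF K)]
    simp [Real.volume_real_Ioc_of_le hle2]

section stage2
variable {Ω : Type*} [MeasurableSpace Ω] {P : Measure Ω} [IsProbabilityMeasure P]
    {A S : Ω → Set ℝ} {lam rho : ℝ≥0}

lemma Sm_aem (hlr : lam < rho)
    (hA : IsPoissonPP P A lam) (hS : IsPoissonPP P S rho) (hi : PPIndep P A S)
    (T m : ℕ) (θ : ℝ → ℝ)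
    (hθ : ∀ n ≥ m, ∀ k, ∀ x ∈ Ioc (tg n k) (tg n (k + 1)), θ x = θ (tg n (k + 1)))
    (hθ0 : ∀ x ∉ Ioc (-(T : ℝ)) T, θ x = 0) :
    AEMeasurable (fun ω => Sm θ (Dep (A ω) (S ω))) P := by
  refine aemeasurable_of_tendsto_metrizable_ae atTop (f := fun n ω =>
    ∑ k ∈ Finset.range ((n + T) * 2 ^ n), θ (tg n (k + 1)) * (dg (A ω) (S ω) (tg n) 0 k : ℝ)) ?_ ?_
  · intro n
    refine Finset.aemeasurable_fun_sum _ fun k _ => ?_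
    exact ((measurable_from_nat (f := fun j : ℕ => (j : ℝ))).comp_aemeasurable
      (dg_aem hA hS n 0 k)).const_mul _
  · filter_upwards [ae_path hlr hA hS hi T m θ hθ hθ0 0] with ω hω
    exact tendsto_nhds_of_eventually_eq hω

lemma lim_E (hlr : lam < rho)
    (hA : IsPoissonPP P A lam) (hS : IsPoissonPP P S rho) (hi : PPIndep P A S)
    (T m : ℕ) (θ : ℝ → ℝ)
    (hθ : ∀ n ≥ m, ∀ k, ∀ x ∈ Ioc (tg n k) (tg n (k + 1)), θ x = θ (tg n (k + 1)))
    (hθ0 : ∀ x ∉ Ioc (-(T : ℝ)) T, θ x = 0) (q : ℕ) :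
    Tendsto (fun n => EK (lam * (1 / 2) ^ n) (rho * (1 / 2) ^ n) ((n + T) * 2 ^ n)
        (fun k => Complex.exp (Complex.I * θ (tg n (k + 1)))) q) atTop
      (nhds (∫ ω, Complex.exp (Complex.I * Sm θ (Dep (A ω) (S ω))) ∂P)) := by
  have key : ∀ n ω, ∏ k ∈ Finset.range ((n + T) * 2 ^ n),
      Complex.exp (Complex.I * θ (tg n (k + 1))) ^ dg (A ω) (S ω) (tg n) q k
      = Complex.exp (Complex.I * ((∑ k ∈ Finset.range ((n + T) * 2 ^ n),
        θ (tg n (k + 1)) * (dg (A ω) (S ω) (tg n) q k : ℝ) : ℝ) : ℂ)) := fun n ω => by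
    push_cast
    rw [Finset.mul_sum, Complex.exp_sum]
    refine Finset.prod_congr rfl fun k _ => ?_
    rw [← Complex.exp_nat_mul]; congr 1; ring
  simp_rw [← E_prod hA hS hi, key]
  refine tendsto_integral_of_dominated_convergence (fun _ => (1 : ℝ)) ?_ (integrable_const _) ?_ ?_
  · intro n
    have : AEMeasurable (fun ω => ∑ k ∈ Finset.range ((n + T) * 2 ^ n),
        θ (tg n (k + 1)) * (dg (A ω) (S ω) (tg n) q k : ℝ)) P := by
      refine Finset.aemeasurable_fun_sum _ fun k _ => ?_
      exact ((measurable_from_nat (f := fun j : ℕ => (j : ℝ))).comp_aemeasurable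
        (dg_aem hA hS n q k)).const_mul _
    have hc : Measurable fun x : ℝ => Complex.exp (Complex.I * x) := by fun_prop
    exact (hc.comp_aemeasurable this).aestronglyMeasurable
  · intro n
    refine Eventually.of_forall fun ω => ?_
    rw [mul_comm, Complex.norm_exp_ofReal_mul_I]
  · filter_upwards [ae_path hlr hA hS hi T m θ hθ hθ0 q] with ω hω
    refine tendsto_nhds_of_eventually_eq ?_
    filter_upwards [hω] with n hn
    rw [hn]

lemma E_grid (hlr : lam < rho)
    (hA : IsPoissonPP P A lam) (hS : IsPoissonPP P S rho) (hi : PPIndep P A S)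
    (T m : ℕ) (θ : ℝ → ℝ)
    (hθ : ∀ n ≥ m, ∀ k, ∀ x ∈ Ioc (tg n k) (tg n (k + 1)), θ x = θ (tg n (k + 1)))
    (hθ0 : ∀ x ∉ Ioc (-(T : ℝ)) T, θ x = 0) :
    ∫ ω, Complex.exp (Complex.I * Sm θ (Dep (A ω) (S ω))) ∂P
      = Complex.exp (lam * ∫ x, (Complex.exp (Complex.I * θ x) - 1)) := by
  have hr : (0 : ℝ) < rho := lt_of_le_of_lt lam.2 (by exact_mod_cast hlr)
  have hlr' : (lam : ℝ) < rho := by exact_mod_cast hlr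
  have x0 : 0 ≤ (lam : ℝ) / rho := by positivity
  have x1 : (lam : ℝ) / rho < 1 := (div_lt_one hr).2 hlr'
  set x : ℝ := lam / rho with hx
  have hz : ∀ n k, ‖Complex.exp (Complex.I * θ (tg n (k + 1)))‖ ≤ 1 := fun n k => by
    rw [mul_comm, Complex.norm_exp_ofReal_mul_I]
  set E : ℂ := ∫ ω, Complex.exp (Complex.I * Sm θ (Dep (A ω) (S ω))) ∂P
  -- limit 1
  have L1 : Tendsto (fun n => ∑' q, (gw x q : ℂ) *
      EK (lam * (1 / 2) ^ n) (rho * (1 / 2) ^ n) ((n + T) * 2 ^ n)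
        (fun k => Complex.exp (Complex.I * θ (tg n (k + 1)))) q) atTop (nhds E) := by
    have h1 : ∑' q, (gw x q : ℂ) * E = E := by
      rw [tsum_mul_right, ← Complex.ofReal_tsum, (gw_hasSum x0 x1).tsum_eq]; simp
    rw [← h1]
    refine tendsto_tsum_of_dominated_convergence (gw_hasSum x0 x1).summable ?_ ?_
    · intro q
      exact (lim_E hlr hA hS hi T m θ hθ hθ0 q).const_mul _
    · refine Eventually.of_forall fun n q => ?_
      rw [norm_mul, Complex.norm_real, Real.norm_of_nonneg (gw_nonneg x0 x1 q)]
      exact mul_le_of_le_one_right (gw_nonneg x0 x1 q) (EK_norm _ _ _ _ (hz n) _)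
  have hpow : Tendsto (fun n : ℕ => (1 / 2 : ℝ) ^ n) atTop (nhds 0) :=
    tendsto_pow_atTop_nhds_zero_of_lt_one (by norm_num) (by norm_num)
  -- Riemann sums
  have R : ∀ᶠ n : ℕ in atTop, ∑ k ∈ Finset.range ((n + T) * 2 ^ n),
      (((lam * (1 / 2) ^ n : ℝ≥0) : ℝ) : ℂ) * (Complex.exp (Complex.I * θ (tg n (k + 1))) - 1)
      = lam * ∫ x, (Complex.exp (Complex.I * θ x) - 1) := by
    filter_upwards [eventually_ge_atTop T, eventually_ge_atTop m] with n hT hm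
    have := (riem (tg_mono n) (fun x => Complex.exp (Complex.I * θ x) - 1)
      (fun k x hx => by simp only [hθ n hm k x hx]) ((n + T) * 2 ^ n)).2
    rw [tg_zero, tg_end, setIntegral_eq_integral_of_forall_compl_eq_zero] at this
    · rw [this, Finset.mul_sum]
      refine Finset.sum_congr rfl fun k _ => ?_
      rw [tg_sub]; push_cast; ring
    · intro x hx
      rw [hθ0 x]; · simp
      intro h; apply hx
      have : (T : ℝ) ≤ n := by exact_mod_cast hT
      exact ⟨by linarith [h.1], h.2⟩
  have L2 : Tendsto (fun n => ∑' q, (gw x q : ℂ) *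
      EK (lam * (1 / 2) ^ n) (rho * (1 / 2) ^ n) ((n + T) * 2 ^ n)
        (fun k => Complex.exp (Complex.I * θ (tg n (k + 1)))) q) atTop
      (nhds (Complex.exp (lam * ∫ x, (Complex.exp (Complex.I * θ x) - 1)))) := by
    rw [tendsto_iff_norm_sub_tendsto_zero]
    have herr : Tendsto (fun n : ℕ => ((n : ℝ) + T) * (1 / 2) ^ n * (9 * ((lam : ℝ) + rho) ^ 2))
        atTop (nhds 0) := by
      have h1 : Tendsto (fun n : ℕ => (n : ℝ) * (1 / 2 : ℝ) ^ n) atTop (nhds 0) :=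
        tendsto_self_mul_const_pow_of_lt_one (by norm_num) (by norm_num)
      have h2 := (h1.add (hpow.const_mul (T : ℝ))).mul_const (9 * ((lam : ℝ) + rho) ^ 2)
      simp only [mul_zero, add_zero, zero_mul] at h2
      refine h2.congr fun n => by ring
    have hl : ∀ᶠ n : ℕ in atTop, 2 * (lam * (1 / 2 : ℝ) ^ n) ≤ 1 := by
      have : Tendsto (fun n : ℕ => 2 * (lam * (1 / 2 : ℝ) ^ n)) atTop (nhds 0) := by
        simpa using (hpow.const_mul (lam : ℝ)).const_mul 2
      exact this.eventually_le_const (by norm_num)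
    refine squeeze_zero' (Eventually.of_forall fun n => norm_nonneg _) ?_ herr
    filter_upwards [R, hl] with n hn hl
    rw [← hn]
    have hp : (0 : ℝ≥0) < (1 / 2) ^ n := by positivity
    have := EK_pi (lam * (1 / 2) ^ n) (rho * (1 / 2) ^ n) (mul_lt_mul_of_pos_right hlr hp)
      (by push_cast; exact hl) (x := x) (by push_cast; rw [hx]; field_simp) ((n + T) * 2 ^ n)
      _ (hz n)
    refine this.trans (le_of_eq ?_)
    push_cast
    have h2 : (2 : ℝ) ^ n * (1 / 2) ^ n = 1 := by rw [← mul_pow]; norm_num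
    linear_combination ((n : ℝ) + T) * 9 * ((lam : ℝ) + rho) ^ 2 * (1 / 2) ^ n * h2
  exact tendsto_nhds_unique L1 L2

end stage2


/-- sets that are unions of grid cells at all fine enough levels -/
def GS : Set (Set ℝ) := {C | MeasurableSet C ∧ ∃ m, ∀ n ≥ m, ∀ k,
  ∀ x ∈ Ioc (tg n k) (tg n (k + 1)), (x ∈ C ↔ tg n (k + 1) ∈ C)}

lemma GS_ring : IsSetRing GS where
  empty_mem := ⟨MeasurableSet.empty, 0, by simp⟩
  union_mem := by
    rintro s t ⟨hs, a, ha⟩ ⟨ht, b, hb⟩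
    refine ⟨hs.union ht, max a b, fun n hn k x hx => ?_⟩
    have := ha n (le_of_max_le_left hn) k x hx
    have := hb n (le_of_max_le_right hn) k x hx
    simp only [mem_union]; tauto
  sdiff_mem := by
    rintro s t ⟨hs, a, ha⟩ ⟨ht, b, hb⟩
    refine ⟨hs.diff ht, max a b, fun n hn k x hx => ?_⟩
    have := ha n (le_of_max_le_left hn) k x hx
    have := hb n (le_of_max_le_right hn) k x hx
    simp only [Set.mem_sdiff]; tauto

lemma GS_univ : univ ∈ GS := ⟨MeasurableSet.univ, 0, by simp⟩

lemma GS_Iic (j : ℤ) (m : ℕ) : Iic ((j : ℝ) * (1 / 2) ^ m) ∈ GS := by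
  refine ⟨measurableSet_Iic, m, fun n hn k x hx => ?_⟩
  simp only [mem_Iic]
  refine ⟨fun h => ?_, fun h => hx.2.trans h⟩
  obtain ⟨d, rfl⟩ := Nat.exists_eq_add_of_le hn
  have hp : (0 : ℝ) < (1 / 2) ^ (m + d) := by positivity
  have e1 : (j : ℝ) * (1 / 2) ^ m = ((j * 2 ^ d : ℤ) : ℝ) * (1 / 2) ^ (m + d) := by
    push_cast; rw [pow_add]
    have : (2 : ℝ) ^ d * (1 / 2) ^ d = 1 := by rw [← mul_pow]; norm_num
    linear_combination -(j : ℝ) * (1 / 2) ^ m * this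
  have e2 : ∀ k : ℕ, tg (m + d) k
      = ((-((m + d : ℕ) : ℤ) * 2 ^ (m + d) + k : ℤ) : ℝ) * (1 / 2) ^ (m + d) := fun k => by
    simp only [tg]; push_cast
    have : (2 : ℝ) ^ (m + d) * (1 / 2) ^ (m + d) = 1 := by rw [← mul_pow]; norm_num
    linear_combination ((m : ℝ) + d) * this
  have h1 := lt_of_lt_of_le hx.1 h
  rw [e1, e2] at h1 ⊢
  rw [mul_lt_mul_iff_left₀ hp] at h1
  rw [mul_le_mul_iff_left₀ hp]
  have h2 : (-((m + d : ℕ) : ℤ) * 2 ^ (m + d) + k : ℤ) < j * 2 ^ d := by exact_mod_cast h1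
  have h3 : (-((m + d : ℕ) : ℤ) * 2 ^ (m + d) + (k + 1 : ℕ) : ℤ) ≤ j * 2 ^ d := by
    push_cast at h2 ⊢; linarith [Int.add_one_le_iff.2 h2]
  exact_mod_cast h3

lemma GS_Ioc (T : ℕ) : Ioc (-(T : ℝ)) T ∈ GS := by
  have h1 := GS_Iic T 0
  have h2 := GS_Iic (-T) 0
  have := GS_ring.sdiff_mem h1 h2
  convert this using 1
  ext x; simp [and_comm]

lemma GS_gen : (inferInstance : MeasurableSpace ℝ) = MeasurableSpace.generateFrom GS := by
  apply le_antisymm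
  · rw [show (inferInstance : MeasurableSpace ℝ) = borel ℝ from BorelSpace.measurable_eq,
      borel_eq_generateFrom_Iic]
    refine MeasurableSpace.generateFrom_le ?_
    rintro _ ⟨a, rfl⟩
    have : Iic a = ⋂ n : ℕ, Iic ((⌈a * 2 ^ n⌉ : ℝ) * (1 / 2) ^ n) := by
      ext x
      simp only [mem_Iic, mem_iInter]
      have hpow : Tendsto (fun n : ℕ => (1 / 2 : ℝ) ^ n) atTop (nhds 0) :=
        tendsto_pow_atTop_nhds_zero_of_lt_one (by norm_num) (by norm_num)
      have h2 : ∀ n : ℕ, (2 : ℝ) ^ n * (1 / 2) ^ n = 1 := fun n => by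
        rw [← mul_pow]; norm_num
      constructor
      · intro h n
        have := mul_le_mul_of_nonneg_right (Int.le_ceil (a * 2 ^ n))
          (show (0 : ℝ) ≤ (1 / 2) ^ n by positivity)
        rw [mul_assoc, h2, mul_one] at this
        linarith
      · intro h
        have h3 : ∀ n : ℕ, x ≤ a + (1 / 2) ^ n := fun n => by
          have := mul_le_mul_of_nonneg_right (Int.ceil_lt_add_one (a * 2 ^ n)).le
            (show (0 : ℝ) ≤ (1 / 2) ^ n by positivity)
          have h4 := h n
          have h5 := h2 n
          linear_combination this + h4 + a * h5
        have := (hpow.const_add a)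
        rw [add_zero] at this
        exact ge_of_tendsto' this h3
    rw [this]
    exact MeasurableSet.iInter fun n => MeasurableSpace.measurableSet_generateFrom (GS_Iic _ _)
  · exact MeasurableSpace.generateFrom_le fun s hs => hs.1

lemma GS_approx (T : ℕ) {B : Set ℝ} (hB : MeasurableSet B) (hT : B ⊆ Ioc (-(T : ℝ)) T) (j : ℕ) :
    ∃ C ∈ GS, C ⊆ Ioc (-(T : ℝ)) T ∧ volume (symmDiff C B) ≤ ENNReal.ofReal ((1 / 2) ^ j) := by
  obtain ⟨C, hC, h⟩ := exists_measure_symmDiff_lt_of_generateFrom_isSetRing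
    (μ := volume.restrict (Ioc (-(T : ℝ)) T)) GS_ring
    ⟨{univ}, countable_singleton _, by simpa using GS_univ, by simp⟩ GS_gen hB
    (ε := ENNReal.ofReal ((1 / 2) ^ j)) (by simp)
  refine ⟨C ∩ Ioc (-(T : ℝ)) T, GS_ring.inter_mem hC (GS_Ioc T), inter_subset_right, ?_⟩
  rw [Measure.restrict_apply (hC.1.symmDiff hB)] at h
  refine (measure_mono ?_).trans h.le
  intro x hx
  have := @hT x
  simp only [mem_symmDiff, mem_inter_iff] at hx ⊢
  tauto

/-- simple function -/
def sf {m : ℕ} (B : Fin m → Set ℝ) (c : Fin m → ℝ) (x : ℝ) : ℝ := ∑ i, if x ∈ B i then c i else 0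

lemma sf_meas {m : ℕ} {B : Fin m → Set ℝ} (hB : ∀ i, MeasurableSet (B i)) (c : Fin m → ℝ) :
    Measurable (sf B c) := by
  unfold sf
  exact Finset.measurable_fun_sum _ fun i _ => Measurable.ite (hB i) measurable_const measurable_const

lemma sf_zero {m : ℕ} {B : Fin m → Set ℝ} {I : Set ℝ} (hB : ∀ i, B i ⊆ I) (c : Fin m → ℝ) {x : ℝ}
    (hx : x ∉ I) : sf B c x = 0 := by
  unfold sf
  exact Finset.sum_eq_zero fun i _ => if_neg fun h => hx (hB i h)

lemma sf_congr {m : ℕ} {B C : Fin m → Set ℝ} (c : Fin m → ℝ) {x : ℝ}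
    (hx : x ∉ ⋃ i, symmDiff (C i) (B i)) : sf C c x = sf B c x := by
  unfold sf
  refine Finset.sum_congr rfl fun i _ => ?_
  have : x ∉ symmDiff (C i) (B i) := fun h => hx (mem_iUnion.2 ⟨i, h⟩)
  rw [mem_symmDiff] at this
  have : x ∈ C i ↔ x ∈ B i := by tauto
  simp only [this]

section stage3
variable {Ω : Type*} [MeasurableSpace Ω] {P : Measure Ω} [IsProbabilityMeasure P]
    {A S : Ω → Set ℝ} {lam rho : ℝ≥0}

lemma E_borel (hlr : lam < rho)
    (hA : IsPoissonPP P A lam) (hS : IsPoissonPP P S rho) (hi : PPIndep P A S)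
    {m : ℕ} (B : Fin m → Set ℝ) (hm : ∀ i, MeasurableSet (B i)) (T : ℕ)
    (hT : ∀ i, B i ⊆ Ioc (-(T : ℝ)) T) (c : Fin m → ℝ) :
    AEMeasurable (fun ω => Sm (sf B c) (Dep (A ω) (S ω))) P ∧
    ∫ ω, Complex.exp (Complex.I * Sm (sf B c) (Dep (A ω) (S ω))) ∂P
      = Complex.exp (lam * ∫ x, (Complex.exp (Complex.I * sf B c x) - 1)) := by
  choose C hC1 hC2 hC3 using fun (j : ℕ) (i : Fin m) => GS_approx T (hm i) (hT i) j
  set V : ℕ → Set ℝ := fun j => ⋃ i, symmDiff (C j i) (B i) with hV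
  have hVm : ∀ j, MeasurableSet (V j) := fun j => MeasurableSet.iUnion fun i =>
    ((hC1 j i).1).symmDiff (hm i)
  have hVT : ∀ j, V j ⊆ Ioc (-(T : ℝ)) T := fun j => iUnion_subset fun i =>
    symmDiff_subset_union.trans (union_subset (hC2 j i) (hT i))
  have hVb : ∀ j, Bornology.IsBounded (V j) := fun j => (Metric.isBounded_Ioc _ _).subset (hVT j)
  have hVv : ∀ j, volume (V j) ≤ ENNReal.ofReal (m * (1 / 2) ^ j) := fun j => by
    refine (measure_iUnion_fintype_le _ _).trans ?_
    refine (Finset.sum_le_sum fun i _ => hC3 j i).trans ?_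
    rw [Finset.sum_const, ← ENNReal.ofReal_nsmul]
    simp
  have hVr : ∀ j, volume.real (V j) ≤ m * (1 / 2) ^ j := fun j =>
    ENNReal.toReal_le_of_le_ofReal (by positivity) (hVv j)
  have hsumm : Summable fun j : ℕ => (m : ℝ) * (1 / 2) ^ j := summable_geometric_two.mul_left _
  have aeV : ∀ᵐ x : ℝ, ∀ᶠ j in atTop, x ∉ V j := ae_eventually_notMem
    (ne_top_of_le_ne_top hsumm.tsum_ofReal_ne_top (ENNReal.tsum_le_tsum hVv))
  have aeP : ∀ᵐ ω ∂P, ∀ᶠ j in atTop, ω ∉ {ω | 1 ≤ (S ω ∩ V j).ncard} := by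
    refine ae_eventually_notMem (ne_top_of_le_ne_top (hsumm.mul_left (rho : ℝ)).tsum_ofReal_ne_top
      (ENNReal.tsum_le_tsum fun j => ?_))
    rw [← ofReal_measureReal]
    refine ENNReal.ofReal_le_ofReal ((PP_ge1 hS (hVm j) (hVb j)).trans ?_)
    exact mul_le_mul_of_nonneg_left (hVr j) rho.2
  have aeS : ∀ᵐ ω ∂P, ∀ᶠ j in atTop,
      Sm (sf (C j) c) (Dep (A ω) (S ω)) = Sm (sf B c) (Dep (A ω) (S ω)) := by
    filter_upwards [aeP, hS.1] with ω h1 h2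
    filter_upwards [h1] with j hj
    unfold Sm
    refine finsum_mem_congr rfl fun x hx => sf_congr c fun hxV => hj ?_
    have hf : (S ω ∩ V j).Finite := (h2.fin_Ioc (-(T : ℝ)) T).subset
      (inter_subset_inter_right _ (hVT j))
    exact (ncard_pos hf).2 ⟨x, Dep_sub _ _ hx, hxV⟩
  have grid : ∀ j, ∃ M, ∀ n ≥ M, ∀ k, ∀ x ∈ Ioc (tg n k) (tg n (k + 1)),
      sf (C j) c x = sf (C j) c (tg n (k + 1)) := fun j => by
    choose M hM using fun i => (hC1 j i).2
    refine ⟨Finset.univ.sup M, fun n hn k x hx => ?_⟩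
    unfold sf
    refine Finset.sum_congr rfl fun i _ => ?_
    have := hM i n ((Finset.le_sup (Finset.mem_univ i)).trans hn) k x hx
    simp only [this]
  choose M hM using grid
  have h0 : ∀ j, ∀ x ∉ Ioc (-(T : ℝ)) T, sf (C j) c x = 0 := fun j x hx => sf_zero (hC2 j) c hx
  have aem := fun j => Sm_aem hlr hA hS hi T (M j) (sf (C j) c) (hM j) (h0 j)
  have hE := fun j => E_grid hlr hA hS hi T (M j) (sf (C j) c) (hM j) (h0 j)
  have hc : Measurable fun x : ℝ => Complex.exp (Complex.I * x) := by fun_prop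
  have hn : ∀ x : ℝ, ‖Complex.exp (Complex.I * x)‖ = 1 := fun x => by
    rw [mul_comm, Complex.norm_exp_ofReal_mul_I]
  refine ⟨aemeasurable_of_tendsto_metrizable_ae atTop aem ?_, ?_⟩
  · filter_upwards [aeS] with ω hω
    exact tendsto_nhds_of_eventually_eq hω
  have L1 : Tendsto (fun j => ∫ ω, Complex.exp (Complex.I * Sm (sf (C j) c) (Dep (A ω) (S ω))) ∂P)
      atTop (nhds (∫ ω, Complex.exp (Complex.I * Sm (sf B c) (Dep (A ω) (S ω))) ∂P)) := by
    refine tendsto_integral_of_dominated_convergence (fun _ => (1 : ℝ)) ?_ (integrable_const _) ?_ ?_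
    · exact fun j => (hc.comp_aemeasurable (aem j)).aestronglyMeasurable
    · exact fun j => Eventually.of_forall fun ω => (hn _).le
    · filter_upwards [aeS] with ω hω
      refine tendsto_nhds_of_eventually_eq ?_
      filter_upwards [hω] with j hj
      rw [hj]
  have L2 : Tendsto (fun j => ∫ x, (Complex.exp (Complex.I * sf (C j) c x) - 1))
      atTop (nhds (∫ x, (Complex.exp (Complex.I * sf B c x) - 1))) := by
    refine tendsto_integral_of_dominated_convergence
      ((Ioc (-(T : ℝ)) T).indicator fun _ => (2 : ℝ)) ?_ ?_ ?_ ?_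
    · exact fun j => ((hc.comp (sf_meas (fun i => (hC1 j i).1) c)).sub_const 1).aestronglyMeasurable
    · exact (integrable_indicator_iff measurableSet_Ioc).2 (integrableOn_const (by simp))
    · refine fun j => Eventually.of_forall fun x => ?_
      by_cases hx : x ∈ Ioc (-(T : ℝ)) T
      · rw [indicator_of_mem hx]
        refine (norm_sub_le _ _).trans ?_
        rw [hn]; norm_num
      · rw [indicator_of_notMem hx, h0 j x hx]; simp
    · filter_upwards [aeV] with x hx
      refine tendsto_nhds_of_eventually_eq ?_
      filter_upwards [hx] with j hj
      rw [sf_congr c hj]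
  have L3 := (Complex.continuous_exp.tendsto _).comp (L2.const_mul (lam : ℂ))
  refine tendsto_nhds_unique L1 (L3.congr fun j => ?_)
  exact (hE j).symm

end stage3


lemma Sm_sf {D : Set ℝ} (hD : LocFin D) {m : ℕ} (B : Fin m → Set ℝ) (T : ℕ)
    (hT : ∀ i, B i ⊆ Ioc (-(T : ℝ)) T) (c : Fin m → ℝ) :
    Sm (sf B c) D = ∑ i, c i * ((D ∩ B i).ncard : ℝ) := by
  have hf := hD.fin_Ioc (-(T : ℝ)) T
  rw [Sm_inter _ D (Ioc (-(T : ℝ)) T) (fun x hx => sf_zero hT c hx),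
    finsum_mem_eq_finite_toFinset_sum _ hf]
  unfold sf
  rw [Finset.sum_comm]
  refine Finset.sum_congr rfl fun i _ => ?_
  rw [← Finset.sum_filter, Finset.sum_const, nsmul_eq_mul, mul_comm]
  congr 2
  rw [← ncard_coe_finset]
  congr 1
  ext x
  have := @hT i x
  simp only [Finset.coe_filter, Finite.mem_toFinset, mem_inter_iff, mem_ofPred_eq]
  tauto

lemma int_sf {m : ℕ} (B : Fin m → Set ℝ) (hm : ∀ i, MeasurableSet (B i)) (T : ℕ)
    (hT : ∀ i, B i ⊆ Ioc (-(T : ℝ)) T) (hd : Pairwise fun i j => Disjoint (B i) (B j))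
    (c : Fin m → ℝ) :
    ∫ x, (Complex.exp (Complex.I * sf B c x) - 1)
      = ∑ i, (volume.real (B i) : ℂ) * (Complex.exp (Complex.I * c i) - 1) := by
  have h1 : ∀ x, Complex.exp (Complex.I * sf B c x) - 1
      = ∑ i, (B i).indicator (fun _ => Complex.exp (Complex.I * c i) - 1) x := fun x => by
    by_cases hx : ∃ i, x ∈ B i
    · obtain ⟨i, hx⟩ := hx
      have hj : ∀ j, j ≠ i → x ∉ B j := fun j hj h => Set.disjoint_left.1 (hd hj) h hx
      unfold sf
      rw [Finset.sum_eq_single i (fun j _ h => if_neg (hj j h)) (by simp),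
        Finset.sum_eq_single i (fun j _ h => indicator_of_notMem (hj j h) _) (by simp),
        if_pos hx, indicator_of_mem hx]
    · push Not at hx
      unfold sf
      rw [Finset.sum_eq_zero (fun j _ => if_neg (hx j)),
        Finset.sum_eq_zero (fun j _ => indicator_of_notMem (hx j) _)]
      simp
  have hfin : ∀ i, volume (B i) ≠ ⊤ := fun i =>
    ((measure_mono (hT i)).trans_lt (by simp)).ne
  simp_rw [h1]
  rw [integral_finsetSum _ fun i _ => (integrable_indicator_iff (hm i)).2
    (integrableOn_const (hfin i))]
  refine Finset.sum_congr rfl fun i _ => ?_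
  rw [integral_indicator_const _ (hm i)]
  simp

section stage4
variable {Ω : Type*} [MeasurableSpace Ω] {P : Measure Ω} [IsProbabilityMeasure P]
    {A S : Ω → Set ℝ} {lam rho : ℝ≥0}

lemma E_final (hlr : lam < rho)
    (hA : IsPoissonPP P A lam) (hS : IsPoissonPP P S rho) (hi : PPIndep P A S)
    {m : ℕ} (B : Fin m → Set ℝ) (hm : ∀ i, MeasurableSet (B i)) (T : ℕ)
    (hT : ∀ i, B i ⊆ Ioc (-(T : ℝ)) T) (hd : Pairwise fun i j => Disjoint (B i) (B j))
    (c : Fin m → ℝ) :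
    AEMeasurable (fun ω => ∑ i, c i * ((Dep (A ω) (S ω) ∩ B i).ncard : ℝ)) P ∧
    ∫ ω, Complex.exp (Complex.I * (∑ i, c i * ((Dep (A ω) (S ω) ∩ B i).ncard : ℝ) : ℝ)) ∂P
      = ∏ i, Complex.exp (lam * volume.real (B i) * (Complex.exp (Complex.I * c i) - 1)) := by
  have hE := E_borel hlr hA hS hi B hm T hT c
  have hae : (fun ω => Sm (sf B c) (Dep (A ω) (S ω)))
      =ᵐ[P] fun ω => ∑ i, c i * ((Dep (A ω) (S ω) ∩ B i).ncard : ℝ) := by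
    filter_upwards [hS.1] with ω hω
    exact Sm_sf (hω.mono (Dep_sub _ _)) B T hT c
  refine ⟨hE.1.congr hae, ?_⟩
  rw [← Complex.exp_sum]
  simp_rw [mul_assoc]
  rw [← Finset.mul_sum, ← int_sf B hm T hT hd, ← hE.2]
  refine integral_congr_ae ?_
  filter_upwards [hae] with ω hω
  rw [hω]

end stage4

/-- Burke's theorem for the stationary M/M/1 queue: if `A` and `S` are
independent homogeneous Poisson processes on `ℝ` of rates `λ` and `ρ` with `0 < λ < ρ`,
then almost surely `A` and `S` are disjoint and `(A,S)` is admissible, and the departure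
process `D(A,S)` is a homogeneous Poisson process of rate `λ`. -/
theorem burke {Ω : Type*} [MeasurableSpace Ω] (P : Measure Ω) [IsProbabilityMeasure P]
    (A S : Ω → Set ℝ) (lam rho : ℝ≥0) (h0 : 0 < lam) (hlr : lam < rho)
    (hApp : IsPoissonPP P A lam) (hSpp : IsPoissonPP P S rho)
    (hindep : PPIndep P A S) :
    (∀ᵐ ω ∂P, Disjoint (A ω) (S ω) ∧ Admissible (A ω) (S ω)) ∧
    IsPoissonPP P (fun ω => Dep (A ω) (S ω)) lam := by
  refine ⟨ae_good hlr hApp hSpp hindep, ?_, ?_⟩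
  · filter_upwards [hSpp.1] with ω hω
    exact hω.mono (Dep_sub _ _)
  intro m B hm hb hd
  have hT1 : ∀ i, ∃ T : ℕ, B i ⊆ Ioc (-(T : ℝ)) T := fun i => by
    obtain ⟨R, hR⟩ := (hb i).subset_closedBall 0
    obtain ⟨T, hT⟩ := exists_nat_gt R
    refine ⟨T, fun x hx => ?_⟩
    have := hR hx
    rw [Metric.mem_closedBall, dist_zero_right, Real.norm_eq_abs, abs_le] at this
    exact ⟨by linarith, by linarith⟩
  choose T' hT' using hT1
  have hT : ∀ i, B i ⊆ Ioc (-((Finset.univ.sup T' : ℕ) : ℝ)) (Finset.univ.sup T' : ℕ) := fun i x hx => by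
    have := hT' i hx
    have h2 : (T' i : ℝ) ≤ (Finset.univ.sup T' : ℕ) := by
      exact_mod_cast Finset.le_sup (Finset.mem_univ i)
    exact ⟨by linarith [this.1], by linarith [this.2]⟩
  let X : Fin m → Ω → ℝ := fun i ω => ((Dep (A ω) (S ω) ∩ B i).ncard : ℝ)
  have hE : ∀ c : Fin m → ℝ, AEMeasurable (fun ω => ∑ i, c i * X i ω) P ∧
      ∫ ω, Complex.exp (Complex.I * (∑ i, c i * X i ω : ℝ)) ∂P
      = ∏ i, Complex.exp (lam * volume.real (B i) * (Complex.exp (Complex.I * c i) - 1)) :=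
    E_final hlr hApp hSpp hindep B hm _ hT hd
  have hs : ∀ i (t : ℝ) ω, ∑ j, (Pi.single i t : Fin m → ℝ) j * X j ω = t * X i ω := fun i t ω => by
    rw [Finset.sum_eq_single i (fun j _ h => by simp [h]) (by simp)]; simp
  have haem : ∀ i, AEMeasurable (X i) P := fun i => by
    have := (hE (Pi.single i 1)).1
    simpa only [hs, one_mul] using this
  have hch : ∀ i t, charFun (P.map (X i)) t
      = Complex.exp (lam * volume.real (B i) * (Complex.exp (Complex.I * t) - 1)) := fun i t => by
    have := (hE (Pi.single i t)).2
    simp only [hs] at this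
    rw [Finset.prod_eq_single i (fun j _ h => by simp [h]) (by simp)] at this
    rw [charFun_apply_real, integral_map (haem i) (by fun_prop)]
    simp only [Pi.single_eq_same] at this
    rw [← this]
    congr 1; ext ω; congr 1; push_cast; ring
  have hfl : ∀ i, (fun ω => (Dep (A ω) (S ω) ∩ B i).ncard) = (fun x : ℝ => ⌊x⌋₊) ∘ X i := fun i => by
    ext ω; simp [X]
  have hNaem : ∀ i, AEMeasurable (fun ω => (Dep (A ω) (S ω) ∩ B i).ncard) P := fun i => by
    rw [hfl i]
    exact Nat.measurable_floor.comp_aemeasurable (haem i)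
  constructor
  · have hind : iIndepFun X P := by
      rw [iIndepFun_iff_charFun_pi haem]
      intro t
      simp_rw [hch]
      have := (hE t).2
      rw [← this, charFun_apply, integral_map (by fun_prop) (by fun_prop)]
      congr 1; ext ω
      rw [mul_comm]; congr 3
    have := hind.comp (fun _ => fun x : ℝ => ⌊x⌋₊) (fun _ => Nat.measurable_floor)
    have he : (fun i ω => (Dep (A ω) (S ω) ∩ B i).ncard) = fun i => (fun x : ℝ => ⌊x⌋₊) ∘ X i :=
      funext hfl
    rw [he]
    exact this
  · intro i
    apply (MeasurableEmbedding.natCast (α := ℝ)).map_injective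
    have : IsProbabilityMeasure (P.map (fun ω => (Dep (A ω) (S ω) ∩ B i).ncard)) :=
      Measure.isProbabilityMeasure_map (hNaem i)
    have : IsProbabilityMeasure ((P.map (fun ω => (Dep (A ω) (S ω) ∩ B i).ncard)).map
      (Nat.cast : ℕ → ℝ)) := Measure.isProbabilityMeasure_map (by fun_prop)
    apply Measure.ext_of_charFun
    ext t
    rw [charFun_map_cast_poissonMeasure,
      AEMeasurable.map_map_of_aemeasurable (by fun_prop) (hNaem i)]
    refine (hch i t).trans ?_
    rw [mul_comm Complex.I]
    push_cast
    rfl
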